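/- Let P be a simplicial poset with vertex set V, let ℓ ≥ 1, and let α ∈ ℤⁿ with −ℓ ≤ αᵢ for all i. Set B = {i : −ℓ < αᵢ < 0}, C = {i : αᵢ = −ℓ}, D = {i : αᵢ > 0}. Then Ext_A^i(A/m_ℓ, A_P)_α ≅ ⊕_{z : supp(z) = B∪D} H̃^{i−|B|−|C|−1}([0̂, z_D] × lk_P(z)_{V∖C}), the sum over faces z of P with support B∪D, where cohomology is reduced simplicial-poset cohomology with coefficients in k. -/

import Mathlib

open scoped Classical
open MvPolynomial

noncomputable section

def IsSimplicialPoset (P : Type*) [Fintype P] [PartialOrder P] [OrderBot P] : Prop :=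
  ∀ y : P, ∃ m : ℕ, Nonempty (Set.Icc (⊥ : P) y ≃o Finset (Fin m))

def MUB {P : Type*} [PartialOrder P] (w y : P) : Set P :=
  {z | z ∈ upperBounds {w, y} ∧ ∀ z' ∈ upperBounds {w, y}, z' ≤ z → z' = z}

variable (P : Type) [Fintype P] [PartialOrder P] [OrderBot P]
variable (k : Type) [Field k]

/-- The defining ideal of the face ring of a simplicial poset. -/
def faceIdeal : Ideal (MvPolynomial P k) :=
  Ideal.span
    ({f | ∃ w y : P, upperBounds {w, y} = ∅ ∧ f = X w * X y} ∪
     {f | ∃ w y m : P, (upperBounds {w, y}).Nonempty ∧ IsGLB {w, y} m ∧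
        f = X w * X y - X m * ∑ z ∈ (Set.toFinite (MUB w y)).toFinset, X z} ∪
     {X (⊥ : P) - 1})

/-- The face ring `A_P = k[P]/I_P` of a simplicial poset. -/
abbrev FaceRing := MvPolynomial P k ⧸ faceIdeal P k

/-- The class of the variable corresponding to a face `y` in the face ring. -/
def fv (y : P) : FaceRing P k := Ideal.Quotient.mk _ (X y)

/-- `r` is a standard monomial with leading variable `z`: a product of powers of
variables along a strictly decreasing chain starting at `z`, with positive exponents. -/
def IsStdMonLead (r : FaceRing P k) (z : P) : Prop :=
  ∃ (c : ℕ) (w : Fin (c + 1) → P) (p : Fin (c + 1) → ℕ),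
    StrictAnti w ∧ (∀ i, 0 < p i) ∧ w 0 = z ∧ r = ∏ i, (fv P k (w i)) ^ (p i)

variable (n : ℕ) (x : Fin n → P)

/-- The ℤⁿ-graded piece of the face ring of degree `α`, with respect to the atom
labelling `x : Fin n → P`: the span of (classes of) monomials of `k[P]` whose
ℤⁿ-degree (each face `y` contributing `e_i` for every atom `x i ≤ y`) is `α`. -/
def facePiece (α : Fin n → ℤ) : Submodule k (FaceRing P k) :=
  Submodule.span k
    {r | ∃ σ : P →₀ ℕ,
      (∀ j : Fin n, (∑ y ∈ σ.support, if x j ≤ y then (σ y : ℤ) else 0) = α j) ∧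
      r = Ideal.Quotient.mk _ (monomial σ (1 : k))}

/-- Cochains of the complex `Hom_A(K_•^ℓ, A_P)`: a free basis of `K_t^ℓ` is indexed by
`t`-subsets of `Fin n`, so `Hom_A(K_t^ℓ, A_P)` is identified with functions from
`t`-subsets to `A_P`; we take functions on all finite subsets at once. -/
abbrev KCochain := Finset (Fin n) → FaceRing P k

/-- The differential of `Hom_A(K_•^ℓ, A_P)`:
`(df)(G) = Σ_{j ∈ G} (-1)^{|{i ∈ G : i < j}|} x_j^ℓ · f(G \ {j})`. -/
def koszulD (ℓ : ℕ) : KCochain P k n →ₗ[k] KCochain P k n :=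
  LinearMap.pi fun G =>
    ∑ j ∈ G, ((-1 : k) ^ ((G.filter fun i => i < j).card)) •
      ((LinearMap.mulLeft k ((fv P k (x j)) ^ ℓ)).comp (LinearMap.proj (G.erase j)))

/-- The degree-`(t, α)` graded piece of the Koszul cochains: functions supported on
`t`-subsets `G`, with value at `G` in the graded piece of degree `α + ℓ·χ_G`. -/
def gradedKC (ℓ t : ℕ) (α : Fin n → ℤ) : Submodule k (KCochain P k n) :=
  Submodule.pi Set.univ fun G =>
    if G.card = t then facePiece P k n x (fun j => α j + if j ∈ G then (ℓ : ℤ) else 0)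
    else ⊥

/-- Cocycles of degree `(t, α)`. -/
def ZK (ℓ t : ℕ) (α : Fin n → ℤ) : Submodule k (KCochain P k n) :=
  LinearMap.ker (koszulD P k n x ℓ) ⊓ gradedKC P k n x ℓ t α

/-- Coboundaries of degree `(t, α)`. -/
def BK (ℓ t : ℕ) (α : Fin n → ℤ) : Submodule k (KCochain P k n) :=
  Submodule.map (koszulD P k n x ℓ) (gradedKC P k n x ℓ (t - 1) α)

/-- The graded piece `Ext_A^t(A/m_ℓ, A_P)_α`, computed as degree-`(t,α)` cohomology
of the complex `Hom_A(K_•^ℓ, A_P)`. -/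
abbrev ExtPiece (ℓ t : ℕ) (α : Fin n → ℤ) :=
  ↥(ZK P k n x ℓ t α) ⧸
    Submodule.comap (ZK P k n x ℓ t α).subtype (BK P k n x ℓ t α)


section Cohomology
variable (Q : Type) [Fintype Q] [PartialOrder Q]

/-- The simplicial coboundary operator of a complex `K` of finite chains in a poset `Q`
(each face being a chain is canonically oriented by the order of `Q`):
`(δf)(s) = Σ_{v ∈ s} (-1)^{|{u ∈ s : u < v}|} f(s \ {v})` for `s ∈ K`, and `0` otherwise. -/
def cDelta (K : Set (Finset Q)) : (Finset Q → k) →ₗ[k] (Finset Q → k) :=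
  LinearMap.pi fun s =>
    if s ∈ K then
      ∑ v ∈ s, ((-1 : k) ^ ((s.filter fun u => u < v).card)) • LinearMap.proj (s.erase v)
    else 0

/-- Cochains of (cohomological) degree `i`: functions supported on faces of `K` with
`i + 1` vertices. -/
def cGraded (K : Set (Finset Q)) (i : ℤ) : Submodule k (Finset Q → k) :=
  Submodule.pi Set.univ fun s => if s ∈ K ∧ (s.card : ℤ) = i + 1 then ⊤ else ⊥

/-- Degree-`i` cocycles. -/
def ZC (K : Set (Finset Q)) (i : ℤ) : Submodule k (Finset Q → k) :=
  LinearMap.ker (cDelta k Q K) ⊓ cGraded k Q K i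

/-- Degree-`i` coboundaries. -/
def BC (K : Set (Finset Q)) (i : ℤ) : Submodule k (Finset Q → k) :=
  Submodule.map (cDelta k Q K) (cGraded k Q K (i - 1))

/-- The degree-`i` cohomology (with coefficients in `k`) of a complex `K` of chains
in `Q`. -/
abbrev Coh (K : Set (Finset Q)) (i : ℤ) :=
  ↥(ZC k Q K i) ⧸ Submodule.comap (ZC k Q K i).subtype (BC k Q K i)

/-- The full complex of chains of `Q` minus its minimal elements: the order complex
`Δ(Q̄)` (including the empty face, so `Coh` of it is *reduced* cohomology). -/
def chainsK : Set (Finset Q) :=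
  {s | (∀ q ∈ s, ¬ IsMin q) ∧ IsChain (· ≤ ·) (↑s : Set Q)}

/-- Reduced cohomology `H̃^i(Q)` of (the order complex of) a poset `Q`. -/
abbrev ReducedCoh (i : ℤ) := Coh k Q (chainsK Q) i

/-- The relative complex of the pair `(Q, R)` for a subset `R ⊆ Q`: faces of the order
complex of `Q` not lying in `R`; `Coh` of it is the relative cohomology `H^i(Q, R)`. -/
def relK (R : Set Q) : Set (Finset Q) :=
  {s | s ∈ chainsK Q ∧ ¬ (↑s : Set Q) ⊆ R}

/-- Relative cohomology `H^i(Q, R)`. -/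
abbrev RelCoh (R : Set Q) (i : ℤ) := Coh k Q (relK Q R) i

/-- The link of a face `F` of the order complex of `Q`. -/
def linkK (F : Finset Q) : Set (Finset Q) :=
  {s | (∀ q ∈ s, q ∉ F) ∧ (∀ q ∈ s ∪ F, ¬ IsMin q) ∧
    IsChain (· ≤ ·) (↑(s ∪ F) : Set Q)}
end Cohomology

/-- The contrastar `cost_P(y) = {z : ¬ y ≤ z}`. -/
def cost {P : Type} [PartialOrder P] (y : P) : Set P := {z | ¬ y ≤ z}

/-- For `D ⊆ supp(z)`, the unique face `z_D ≤ z` with support `D` (chosen by choice). -/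
def subface (z : P) (D : Finset (Fin n)) : P :=
  @Classical.epsilon P ⟨⊥⟩ fun w => w ≤ z ∧ ∀ i : Fin n, x i ≤ w ↔ i ∈ D


section HelperAbs

lemma qi_single {k V W : Type*} [Field k] [AddCommGroup V] [Module k V] [AddCommGroup W] [Module k W]
    (Z B : Submodule k V) (Z' B' : Submodule k W) (ρ : V →ₗ[k] W)
    (h1 : ∀ v ∈ Z, ρ v ∈ Z') (h2 : ∀ v ∈ Z, v ∈ B ↔ ρ v ∈ B')
    (h3 : ∀ w ∈ Z', ∃ v ∈ Z, ρ v - w ∈ B') :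
    Nonempty ((↥Z ⧸ Submodule.comap Z.subtype B) ≃ₗ[k] (↥Z' ⧸ Submodule.comap Z'.subtype B')) := by
  let F : ↥Z →ₗ[k] (↥Z' ⧸ Submodule.comap Z'.subtype B') :=
    (Submodule.mkQ _).comp (ρ.restrict h1)
  have hker : LinearMap.ker F = Submodule.comap Z.subtype B := by
    ext v
    simp only [F, LinearMap.mem_ker, LinearMap.comp_apply, Submodule.mkQ_apply,
      Submodule.Quotient.mk_eq_zero, Submodule.mem_comap, Submodule.subtype_apply,
      LinearMap.coe_restrict_apply]
    exact (h2 v v.2).symm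
  have hs : Function.Surjective F := by
    intro y
    obtain ⟨w, rfl⟩ := Submodule.mkQ_surjective _ y
    obtain ⟨v, hv, hvw⟩ := h3 w w.2
    refine ⟨⟨v, hv⟩, ?_⟩
    simp only [F, LinearMap.comp_apply, Submodule.mkQ_apply]
    rw [Submodule.Quotient.eq]
    simpa using hvw
  exact ⟨(Submodule.quotEquivOfEq _ _ hker.symm).trans (F.quotKerEquivOfSurjective hs)⟩

lemma qi_pi {k V I : Type*} [Field k] [AddCommGroup V] [Module k V] {W : I → Type*}
    [∀ i, AddCommGroup (W i)] [∀ i, Module k (W i)]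
    (Z B : Submodule k V) (Z' B' : ∀ i, Submodule k (W i)) (ρ : ∀ i, V →ₗ[k] W i)
    (h1 : ∀ v ∈ Z, ∀ i, ρ i v ∈ Z' i) (h2 : ∀ v ∈ Z, v ∈ B ↔ ∀ i, ρ i v ∈ B' i)
    (h3 : ∀ w : ∀ i, W i, (∀ i, w i ∈ Z' i) → ∃ v ∈ Z, ∀ i, ρ i v - w i ∈ B' i) :
    Nonempty ((↥Z ⧸ Submodule.comap Z.subtype B) ≃ₗ[k]
      (∀ i, (↥(Z' i) ⧸ Submodule.comap (Z' i).subtype (B' i)))) := by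
  let F : ↥Z →ₗ[k] (∀ i, (↥(Z' i) ⧸ Submodule.comap (Z' i).subtype (B' i))) :=
    LinearMap.pi fun i => (Submodule.mkQ _).comp ((ρ i).restrict (fun v hv => h1 v hv i))
  have hker : LinearMap.ker F = Submodule.comap Z.subtype B := by
    ext v
    simp only [F, LinearMap.mem_ker, funext_iff, LinearMap.pi_apply, Pi.zero_apply,
      LinearMap.comp_apply, Submodule.mkQ_apply,
      Submodule.Quotient.mk_eq_zero, Submodule.mem_comap, Submodule.subtype_apply,
      LinearMap.coe_restrict_apply]
    exact (h2 v v.2).symm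
  have hs : Function.Surjective F := by
    intro y
    choose w hw using fun i => Submodule.mkQ_surjective _ (y i)
    obtain ⟨v, hv, hvw⟩ := h3 (fun i => w i) (fun i => (w i).2)
    refine ⟨⟨v, hv⟩, ?_⟩
    ext i
    rw [← hw i]
    simp only [F, LinearMap.pi_apply, LinearMap.comp_apply, Submodule.mkQ_apply]
    rw [Submodule.Quotient.eq]
    simpa using hvw i
  exact ⟨(Submodule.quotEquivOfEq _ _ hker.symm).trans (F.quotKerEquivOfSurjective hs)⟩

lemma qi_of_acyclic {k V W : Type*} [Field k] [AddCommGroup V] [Module k V]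
    [AddCommGroup W] [Module k W]
    (d : V →ₗ[k] V) (dW : W →ₗ[k] W) (ρ : V →ₗ[k] W)
    (Vg : ℤ → Submodule k V) (Wg : ℤ → Submodule k W)
    (dd : ∀ v, d (d v) = 0) (dgr : ∀ t, ∀ v ∈ Vg t, d v ∈ Vg (t + 1))
    (ρd : ∀ v, ρ (d v) = dW (ρ v)) (ρgr : ∀ t, ∀ v ∈ Vg t, ρ v ∈ Wg t)
    (lift : ∀ t, ∀ w ∈ Wg t, ∃ v ∈ Vg t, ρ v = w)
    (acyc : ∀ t, ∀ v ∈ Vg t, d v = 0 → ρ v = 0 → ∃ u ∈ Vg (t - 1), ρ u = 0 ∧ d u = v) (t : ℤ) :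
    Nonempty ((↥(LinearMap.ker d ⊓ Vg t) ⧸ Submodule.comap (LinearMap.ker d ⊓ Vg t).subtype
        (Submodule.map d (Vg (t - 1)))) ≃ₗ[k]
      (↥(LinearMap.ker dW ⊓ Wg t) ⧸ Submodule.comap (LinearMap.ker dW ⊓ Wg t).subtype
        (Submodule.map dW (Wg (t - 1))))) := by
  apply qi_single _ _ _ _ ρ
  · rintro v ⟨hv, hv'⟩
    refine ⟨?_, ρgr t v hv'⟩
    have hv0 : d v = 0 := hv
    change dW (ρ v) = 0
    rw [← ρd, hv0, map_zero]
  · rintro v ⟨hv, hv'⟩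
    have hv0 : d v = 0 := hv
    constructor
    · rintro ⟨u, hu, rfl⟩
      exact ⟨ρ u, ρgr _ u hu, (ρd u).symm⟩
    · rintro ⟨w, hw, hwv⟩
      obtain ⟨u, hu, rfl⟩ := lift _ w hw
      have h1 : v - d u ∈ Vg t := by
        refine Submodule.sub_mem _ hv' ?_
        simpa using dgr _ u hu
      obtain ⟨u', hu', -, h⟩ := acyc t (v - d u) h1 (by rw [map_sub, hv0, dd, sub_zero])
        (by rw [map_sub, ρd, ← hwv, sub_self])
      refine ⟨u' + u, Submodule.add_mem _ hu' hu, ?_⟩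
      rw [map_add, h, sub_add_cancel]
  · rintro w ⟨hw, hw'⟩
    have hw0 : dW w = 0 := hw
    obtain ⟨v, hv, rfl⟩ := lift _ w hw'
    obtain ⟨u, hu, hu0, h⟩ := acyc (t + 1) (d v) (dgr _ v hv) (dd v) (by rw [ρd, hw0])
    refine ⟨v - u, ⟨?_, ?_⟩, ?_⟩
    · change d (v - u) = 0
      rw [map_sub, h, sub_self]
    · exact Submodule.sub_mem _ hv (by simpa using hu)
    · rw [map_sub, hu0, sub_zero, sub_self]
      exact Submodule.zero_mem _

lemma acyc_of_filtration {k V : Type*} [Field k] [AddCommGroup V] [Module k V]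
    (d : V →ₗ[k] V) (dd : ∀ v, d (d v) = 0) (K : Submodule k V) (Fil : ℕ → Submodule k V)
    (M : ℕ) (hM : Fil M = ⊥)
    (h : ∀ m, m < M → ∀ v ∈ Fil m, d v = 0 → ∃ u ∈ K, v - d u ∈ Fil (m + 1)) :
    ∀ m ≤ M, ∀ v ∈ Fil m, d v = 0 → ∃ u ∈ K, d u = v := by
  intro m hm
  induction hm using Nat.decreasingInduction with
  | self =>
    intro v hv _
    rw [hM] at hv
    exact ⟨0, Submodule.zero_mem _, by rw [map_zero, (Submodule.mem_bot k).1 hv]⟩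
  | of_succ m hm ih =>
    intro v hv hv0
    obtain ⟨u, hu, huv⟩ := h m hm v hv hv0
    obtain ⟨u', hu', h'⟩ := ih _ huv (by rw [map_sub, hv0, dd, sub_zero])
    refine ⟨u' + u, Submodule.add_mem _ hu' hu, ?_⟩
    rw [map_add, h', sub_add_cancel]

/-- Sign of `j` in `S`. -/
def sg (k : Type*) [Field k] {ι : Type*} (lt : ι → ι → Prop) (S : Finset ι) (j : ι) : k :=
  (-1) ^ ((S.filter fun i => lt i j).card)

lemma sg_mul_self {k : Type*} [Field k] {ι : Type*} (lt : ι → ι → Prop) (S : Finset ι) (j : ι) :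
    sg k lt S j * sg k lt S j = 1 := by
  unfold sg
  rw [← mul_pow]; simp

lemma sg_swap' {k : Type*} [Field k] {ι : Type*} [DecidableEq ι] (lt : ι → ι → Prop)
    (asym : ∀ u v, lt u v → ¬ lt v u) (S : Finset ι) (i j : ι) (hi : i ∈ S)
    (hlt : lt i j) :
    sg k lt S j * sg k lt (S.erase j) i = - (sg k lt S i * sg k lt (S.erase i) j) := by
  have h1 : sg k lt (S.erase j) i = sg k lt S i := by
    unfold sg
    congr 2
    ext u
    simp only [Finset.mem_filter, Finset.mem_erase]
    constructor
    · rintro ⟨⟨_, h⟩, h'⟩; exact ⟨h, h'⟩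
    · rintro ⟨h, h'⟩
      refine ⟨⟨?_, h⟩, h'⟩
      rintro rfl
      exact asym _ _ hlt h'
  have h2 : sg k lt S j = - sg k lt (S.erase i) j := by
    unfold sg
    have : (S.filter fun u => lt u j) = insert i ((S.erase i).filter fun u => lt u j) := by
      ext u
      simp only [Finset.mem_filter, Finset.mem_erase, Finset.mem_insert]
      by_cases hu : u = i
      · subst hu; simp [hi, hlt]
      · simp [hu]
    rw [this, Finset.card_insert_of_notMem (by simp), pow_succ]
    ring
  rw [h1, h2]; ring

lemma sg_swap {k : Type*} [Field k] {ι : Type*} [DecidableEq ι] (lt : ι → ι → Prop)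
    (asym : ∀ u v, lt u v → ¬ lt v u) (S : Finset ι) (i j : ι) (hi : i ∈ S) (hj : j ∈ S)
    (hlt : lt i j ∨ lt j i) :
    sg k lt S j * sg k lt (S.erase j) i = - (sg k lt S i * sg k lt (S.erase i) j) := by
  rcases hlt with h | h
  · exact sg_swap' lt asym S i j hi h
  · rw [sg_swap' lt asym S j i hj h, neg_neg]

lemma antisymm_sum {k : Type*} [Field k] {ι : Type*} [DecidableEq ι] (R : Finset ι) (g : ι → ι → k)
    (h : ∀ i ∈ R, ∀ j ∈ R, i ≠ j → g i j = - g j i) :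
    ∑ i ∈ R, ∑ j ∈ R.erase i, g i j = 0 := by
  rw [Finset.sum_sigma']
  refine Finset.sum_involution (fun p _ => ⟨p.2, p.1⟩) ?_ ?_ ?_ ?_
  · rintro ⟨i, j⟩ hp
    simp only [Finset.mem_sigma, Finset.mem_erase] at hp
    simp only
    rw [h i hp.1 j hp.2.2 (Ne.symm hp.2.1)]; ring
  · rintro ⟨i, j⟩ hp _ heq
    simp only [Finset.mem_sigma, Finset.mem_erase] at hp
    simp only [Sigma.mk.injEq, heq_eq_eq] at heq
    exact hp.2.1 heq.1
  · rintro ⟨i, j⟩ hp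
    simp only [Finset.mem_sigma, Finset.mem_erase] at hp ⊢
    exact ⟨hp.2.2, Ne.symm hp.2.1, hp.1⟩
  · rintro ⟨i, j⟩ hp
    rfl

/-- Contraction by toggling `a`. -/
def tog (k : Type*) [Field k] {ι : Type*} [DecidableEq ι] (lt : ι → ι → Prop) (a : ι)
    (F : Finset ι → k) (T : Finset ι) : k :=
  if a ∈ T then 0 else sg k lt (insert a T) a * F (insert a T)

lemma tog_mem {k : Type*} [Field k] {ι : Type*} [DecidableEq ι] (lt : ι → ι → Prop) (a : ι)
    (F : Finset ι → k) (S R : Finset ι) (haS : a ∈ S) (ha : a ∈ R) :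
    ∑ j ∈ R, sg k lt S j * tog k lt a F (S.erase j) = F S := by
  rw [Finset.sum_eq_single a]
  · unfold tog
    rw [if_neg (by simp), Finset.insert_erase haS, ← mul_assoc, sg_mul_self, one_mul]
  · intro j _ hj
    unfold tog
    rw [if_pos (by simp [haS, Ne.symm hj]), mul_zero]
  · intro h; exact absurd ha h

lemma tog_notMem {k : Type*} [Field k] {ι : Type*} [DecidableEq ι] (lt : ι → ι → Prop)
    (asym : ∀ u v, lt u v → ¬ lt v u) (a : ι)
    (F : Finset ι → k) (S R : Finset ι) (hR : R ⊆ S) (haS : a ∉ S)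
    (htri : ∀ j ∈ R, lt a j ∨ lt j a)
    (h0 : ∑ j ∈ insert a R, sg k lt (insert a S) j * F ((insert a S).erase j) = 0) :
    ∑ j ∈ R, sg k lt S j * tog k lt a F (S.erase j) = F S := by
  have haR : a ∉ R := fun h => haS (hR h)
  rw [Finset.sum_insert haR, Finset.erase_insert haS] at h0
  have key : ∀ j ∈ R, sg k lt S j * tog k lt a F (S.erase j)
      = - sg k lt (insert a S) a * (sg k lt (insert a S) j * F ((insert a S).erase j)) := by
    intro j hj
    have hja : j ≠ a := fun h => haR (h ▸ hj)
    unfold tog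
    rw [if_neg (by simp [haS])]
    have e : insert a (S.erase j) = (insert a S).erase j := by
      rw [Finset.erase_insert_of_ne hja.symm]
    rw [e]
    have := sg_swap (k := k) lt asym (insert a S) j a (by simp [hR hj]) (by simp) (htri j hj).symm
    rw [Finset.erase_insert haS] at this
    have h2 := sg_mul_self (k := k) lt (insert a S) a
    calc sg k lt S j * (sg k lt ((insert a S).erase j) a * F ((insert a S).erase j))
        = (sg k lt (insert a S) a * sg k lt (insert a S) a) * sg k lt S j * sg k lt ((insert a S).erase j) a * F ((insert a S).erase j) := by
          rw [h2]; ring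
      _ = sg k lt (insert a S) a * (sg k lt (insert a S) a * sg k lt S j) * sg k lt ((insert a S).erase j) a * F ((insert a S).erase j) := by ring
      _ = _ := by
          rw [this]
          have h3 := sg_mul_self (k := k) lt ((insert a S).erase j) a
          linear_combination (- sg k lt (insert a S) a * sg k lt (insert a S) j * F ((insert a S).erase j)) * h3
  rw [Finset.sum_congr rfl key, ← Finset.mul_sum, eq_neg_of_add_eq_zero_right h0]
  linear_combination F S * sg_mul_self (k := k) lt (insert a S) a

end HelperAbs

section HelperCell
set_option linter.unusedSectionVars false

structure CellData {Q : Type} [PartialOrder Q] {n : ℕ} (G : Q → Finset (Fin n)) (b : Q)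
    (fc : Q → Finset (Fin n) → Q) : Prop where
  hb : ∀ q, b ≤ q
  mono : ∀ q q', q ≤ q' → G q ⊆ G q'
  fc_le : ∀ q S, G b ⊆ S → S ⊆ G q → fc q S ≤ q
  G_fc : ∀ q S, G b ⊆ S → S ⊆ G q → G (fc q S) = S
  uniq : ∀ q q₁ q₂, q₁ ≤ q → q₂ ≤ q → G q₁ = G q₂ → q₁ = q₂

variable {Q : Type} [Fintype Q] [PartialOrder Q] {n : ℕ} {G : Q → Finset (Fin n)} {b : Q}
    {fc : Q → Finset (Fin n) → Q}

lemma CellData.fc_eq (h : CellData G b fc) {q q' : Q} (hq : q' ≤ q) : fc q (G q') = q' :=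
  h.uniq q _ _ (h.fc_le q _ (h.mono _ _ (h.hb _)) (h.mono _ _ hq)) hq
    (h.G_fc q _ (h.mono _ _ (h.hb _)) (h.mono _ _ hq))

lemma CellData.fc_sub (h : CellData G b fc) {q q' : Q} (hq : q' ≤ q) (S : Finset (Fin n))
    (hb : G b ⊆ S) (hS : S ⊆ G q') : fc q' S = fc q S :=
  h.uniq q _ _ ((h.fc_le q' _ hb hS).trans hq) (h.fc_le q _ hb (hS.trans (h.mono _ _ hq)))
    ((h.G_fc q' _ hb hS).trans (h.G_fc q _ hb (hS.trans (h.mono _ _ hq))).symm)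

lemma CellData.isMin_iff (h : CellData G b fc) (q : Q) : IsMin q ↔ q = b := by
  constructor
  · intro hq; exact le_antisymm (hq (h.hb q)) (h.hb q)
  · rintro rfl; intro c _; exact h.hb c

variable (k : Type) [Field k] (G b fc)

/-- Cellular coboundary. -/
def dCell : (Q → k) →ₗ[k] (Q → k) where
  toFun g := fun q => ∑ j ∈ G q \ G b, sg k (· < ·) (G q) j * g (fc q ((G q).erase j))
  map_add' f g := by
    ext q; simp [mul_add, Finset.sum_add_distrib]
  map_smul' c g := by
    ext q; simp [Finset.mul_sum, mul_left_comm]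

/-- Graded pieces of the cellular complex. -/
def grCell (t : ℤ) : Submodule k (Q → k) where
  carrier := {g | ∀ q, ((G q).card : ℤ) ≠ t → g q = 0}
  add_mem' := by
    intro f g hf hg q hq
    simp [hf q hq, hg q hq]
  zero_mem' := by intro q _; rfl
  smul_mem' := by
    intro c f hf q hq
    simp [hf q hq]

lemma dCell_dCell (h : CellData G b fc) (g : Q → k) : dCell G b fc k (dCell G b fc k g) = 0 := by
  ext q
  have e : ∀ j ∈ G q \ G b, sg k (· < ·) (G q) j * (dCell G b fc k g) (fc q ((G q).erase j))
      = ∑ i ∈ (G q \ G b).erase j, sg k (· < ·) (G q) j * (sg k (· < ·) ((G q).erase j) i *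
          g (fc q (((G q).erase j).erase i))) := by
    intro j hj
    rw [Finset.mem_sdiff] at hj
    have hbS : G b ⊆ (G q).erase j := by
      intro i hi
      refine Finset.mem_erase.2 ⟨?_, h.mono _ _ (h.hb q) hi⟩
      rintro rfl; exact hj.2 hi
    have hG := h.G_fc q _ hbS (Finset.erase_subset _ _)
    have hle := h.fc_le q _ hbS (Finset.erase_subset _ _)
    simp only [dCell, LinearMap.coe_mk, AddHom.coe_mk]
    rw [hG, Finset.erase_sdiff_comm, Finset.mul_sum]
    refine Finset.sum_congr rfl fun i hi => ?_
    rw [h.fc_sub hle]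
    · intro u hu
      refine Finset.mem_erase.2 ⟨?_, hbS hu⟩
      rintro rfl
      simp at hi
      exact hi.2.2 hu
    · rw [hG]; exact Finset.erase_subset _ _
  change ∑ j ∈ G q \ G b, sg k (· < ·) (G q) j * (dCell G b fc k g) (fc q ((G q).erase j)) = 0
  rw [Finset.sum_congr rfl e]
  refine antisymm_sum _ _ fun i hi j hj hij => ?_
  rw [Finset.mem_sdiff] at hi hj
  rw [← mul_assoc, ← mul_assoc, sg_swap (k := k) (· < ·) (fun u v h => lt_asymm h) (G q) j i hj.1 hi.1
    (lt_or_gt_of_ne (Ne.symm hij)), Finset.erase_right_comm]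
  ring

/-- Valid pairs. -/
def Vld (q : Q) (s : Finset Q) : Prop := s ∈ chainsK Q ∧ ∀ u ∈ s, q ≤ u

lemma Vld.sub {q q' : Q} {s s' : Finset Q} (h : Vld q s) (hq : q' ≤ q) (hs : s' ⊆ s) : Vld q' s' :=
  ⟨⟨fun u hu => h.1.1 u (hs hu), h.1.2.mono (by exact_mod_cast hs)⟩,
    fun u hu => hq.trans (h.2 u (hs hu))⟩

/-- Simplicial part of the total differential. -/
def dS (f : Finset Q → k) (s : Finset Q) : k := ∑ v ∈ s, sg k (· < ·) s v * f (s.erase v)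

/-- Total differential. -/
def dTot : (Q → Finset Q → k) →ₗ[k] (Q → Finset Q → k) where
  toFun f := fun q s => if Vld q s then dS k (f q) s +
      (-1) ^ s.card * dCell G b fc k (fun q' => f q' s) q else 0
  map_add' f g := by
    ext q s
    by_cases h : Vld q s
    · simp only [h, if_true, Pi.add_apply]
      have : (fun q' => f q' s + g q' s) = (fun q' => f q' s) + (fun q' => g q' s) := rfl
      rw [this, map_add]
      simp only [dS, Pi.add_apply, mul_add, Finset.sum_add_distrib]
      ring
    · simp [h]
  map_smul' c f := by
    ext q s
    by_cases h : Vld q s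
    · simp only [h, if_true, Pi.smul_apply, smul_eq_mul, RingHom.id_apply]
      have : (fun q' => c * f q' s) = c • (fun q' => f q' s) := rfl
      rw [this, map_smul]
      simp only [dS, Pi.smul_apply, smul_eq_mul, mul_add, Finset.mul_sum]
      congr 1
      · exact Finset.sum_congr rfl fun v _ => by ring
      · ring
    · simp [h]

/-- Graded pieces of the total complex. -/
def grTot (t : ℤ) : Submodule k (Q → Finset Q → k) where
  carrier := {g | ∀ q s, ¬ (Vld q s ∧ ((G q).card : ℤ) + s.card = t) → g q s = 0}
  add_mem' := by
    intro f g hf hg q s hq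
    simp [hf q s hq, hg q s hq]
  zero_mem' := by intro q s _; rfl
  smul_mem' := by
    intro c f hf q s hq
    simp [hf q s hq]

lemma chain_tri {s : Finset Q} (hs : s ∈ chainsK Q) {u v : Q} (hu : u ∈ s) (hv : v ∈ s)
    (huv : u ≠ v) : u < v ∨ v < u := by
  rcases hs.2 hu hv huv with h | h
  · exact Or.inl (lt_of_le_of_ne h huv)
  · exact Or.inr (lt_of_le_of_ne h huv.symm)

lemma dS_dS (f : Finset Q → k) {s : Finset Q} (hs : s ∈ chainsK Q) :
    ∑ v ∈ s, sg k (· < ·) s v * dS k f (s.erase v) = 0 := by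
  unfold dS
  simp only [Finset.mul_sum]
  refine antisymm_sum _ _ fun i hi j hj hij => ?_
  rw [← mul_assoc, ← mul_assoc, sg_swap (k := k) (· < ·) (fun u v h => lt_asymm h) s j i hj hi
    (chain_tri hs hj hi hij.symm), Finset.erase_right_comm]
  ring

lemma CellData.sub_erase (h : CellData G b fc) {q : Q} {j : Fin n} (hj : j ∈ G q \ G b) :
    G b ⊆ (G q).erase j := by
  intro i hi
  refine Finset.mem_erase.2 ⟨?_, h.mono _ _ (h.hb q) hi⟩
  rintro rfl; exact (Finset.mem_sdiff.1 hj).2 hi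

lemma CellData.erase_le (h : CellData G b fc) {q : Q} {j : Fin n} (hj : j ∈ G q \ G b) :
    fc q ((G q).erase j) ≤ q :=
  h.fc_le _ _ (CellData.sub_erase G b fc h hj) (Finset.erase_subset _ _)

lemma CellData.G_erase (h : CellData G b fc) {q : Q} {j : Fin n} (hj : j ∈ G q \ G b) :
    G (fc q ((G q).erase j)) = (G q).erase j :=
  h.G_fc _ _ (CellData.sub_erase G b fc h hj) (Finset.erase_subset _ _)

lemma dTot_dTot (h : CellData G b fc) (f : Q → Finset Q → k) :
    dTot G b fc k (dTot G b fc k f) = 0 := by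
  ext q s
  by_cases hv : Vld q s
  swap
  · simp [dTot, hv]
  change (if Vld q s then dS k (dTot G b fc k f q) s +
      (-1) ^ s.card * dCell G b fc k (fun q' => dTot G b fc k f q' s) q else 0) = 0
  rw [if_pos hv]
  have e1 : dS k (dTot G b fc k f q) s = ∑ v ∈ s, sg k (· < ·) s v * ((-1) ^ (s.erase v).card *
      dCell G b fc k (fun q' => f q' (s.erase v)) q) := by
    have : dS k (dTot G b fc k f q) s = ∑ v ∈ s, sg k (· < ·) s v * dS k (f q) (s.erase v)
        + ∑ v ∈ s, sg k (· < ·) s v * ((-1) ^ (s.erase v).card *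
      dCell G b fc k (fun q' => f q' (s.erase v)) q) := by
      rw [← Finset.sum_add_distrib]
      refine Finset.sum_congr rfl fun v _ => ?_
      rw [← mul_add]
      congr 1
      exact if_pos (hv.sub le_rfl (Finset.erase_subset _ _))
    rw [this, dS_dS k _ hv.1, zero_add]
  have e2 : dCell G b fc k (fun q' => dTot G b fc k f q' s) q
      = ∑ j ∈ G q \ G b, sg k (· < ·) (G q) j * dS k (f (fc q ((G q).erase j))) s := by
    have : dCell G b fc k (fun q' => dTot G b fc k f q' s) q
      = ∑ j ∈ G q \ G b, sg k (· < ·) (G q) j * dS k (f (fc q ((G q).erase j))) s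
        + (-1) ^ s.card * dCell G b fc k (dCell G b fc k (fun q' => f q' s)) q := by
      rw [show dCell G b fc k (dCell G b fc k (fun q' => f q' s)) q =
        ∑ j ∈ G q \ G b, sg k (· < ·) (G q) j *
          (dCell G b fc k (fun q' => f q' s)) (fc q ((G q).erase j)) from rfl,
        Finset.mul_sum, ← Finset.sum_add_distrib]
      refine Finset.sum_congr rfl fun j hj => ?_
      rw [mul_left_comm, ← mul_add]
      congr 1
      exact if_pos (hv.sub (CellData.erase_le G b fc h hj) le_rfl)
    rw [this, dCell_dCell G b fc k h]
    simp
  rw [e1, e2]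
  have e3 : ∀ v ∈ s, sg k (· < ·) s v * ((-1) ^ (s.erase v).card *
      dCell G b fc k (fun q' => f q' (s.erase v)) q) = - ((-1) ^ s.card *
        ∑ j ∈ G q \ G b, sg k (· < ·) s v *
          (sg k (· < ·) (G q) j * f (fc q ((G q).erase j)) (s.erase v))) := by
    intro v hvs
    have hc : s.card = (s.erase v).card + 1 := (Finset.card_erase_add_one hvs).symm
    rw [hc, pow_succ, ← Finset.mul_sum]
    simp only [dCell, LinearMap.coe_mk, AddHom.coe_mk]
    ring
  rw [Finset.sum_congr rfl e3, Finset.sum_neg_distrib, ← Finset.mul_sum, Finset.sum_comm,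
    neg_add_eq_zero]
  congr 1
  refine Finset.sum_congr rfl fun j _ => ?_
  unfold dS
  rw [Finset.mul_sum]
  exact Finset.sum_congr rfl fun v _ => by ring


lemma sum_dTot_gr (h : CellData G b fc) (t : ℤ) (f : Q → Finset Q → k) (hf : f ∈ grTot G k t) :
    dTot G b fc k f ∈ grTot G k (t + 1) := by
  intro q s hqs
  change (if Vld q s then dS k (f q) s +
      (-1) ^ s.card * dCell G b fc k (fun q' => f q' s) q else 0) = 0
  by_cases hv : Vld q s
  swap
  · simp [hv]
  rw [if_pos hv]
  have hne : ((G q).card : ℤ) + s.card ≠ t + 1 := fun h => hqs ⟨hv, h⟩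
  have e1 : dS k (f q) s = 0 := by
    refine Finset.sum_eq_zero fun v hvs => ?_
    rw [hf, mul_zero]
    rintro ⟨_, h'⟩
    have := Finset.card_erase_add_one hvs
    apply hne; omega
  have e2 : dCell G b fc k (fun q' => f q' s) q = 0 := by
    refine Finset.sum_eq_zero fun j hj => ?_
    simp only
    rw [hf, mul_zero]
    rintro ⟨_, h'⟩
    rw [CellData.G_erase G b fc h hj] at h'
    have := Finset.card_erase_add_one (Finset.mem_sdiff.1 hj).1
    apply hne; omega
  rw [e1, e2]; simp

lemma dTot_apply (f : Q → Finset Q → k) {q : Q} {s : Finset Q} (hv : Vld q s) :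
    dTot G b fc k f q s = dS k (f q) s +
      (-1) ^ s.card * dCell G b fc k (fun q' => f q' s) q := if_pos hv

lemma acyc_order (h : CellData G b fc) (t : ℤ) (f : Q → Finset Q → k) (hf : f ∈ grTot G k t)
    (hd : dTot G b fc k f = 0) (hfb : f b = 0) :
    ∃ u ∈ grTot G k (t - 1), u b = 0 ∧ dTot G b fc k u = f := by
  let K : Submodule k (Q → Finset Q → k) := grTot G k (t - 1) ⊓
    LinearMap.ker (LinearMap.proj (R := k) (φ := fun _ : Q => Finset Q → k) b)
  let Fil : ℕ → Submodule k (Q → Finset Q → k) := fun m =>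
    { carrier := {g | g ∈ grTot G k t ∧ ∀ q s, (G q).card ≤ (G b).card + m → g q s = 0}
      add_mem' := by
        rintro g g' ⟨h1, h2⟩ ⟨h3, h4⟩
        refine ⟨Submodule.add_mem _ h1 h3, fun q s hq => ?_⟩
        simp [h2 q s hq, h4 q s hq]
      zero_mem' := ⟨Submodule.zero_mem _, fun _ _ _ => rfl⟩
      smul_mem' := by
        rintro c g ⟨h1, h2⟩
        refine ⟨Submodule.smul_mem _ _ h1, fun q s hq => ?_⟩
        simp [h2 q s hq] }
  have hM : Fil n = ⊥ := by
    rw [eq_bot_iff]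
    rintro g ⟨_, hg⟩
    rw [Submodule.mem_bot]
    ext q s
    refine hg q s ?_
    have := Finset.card_le_univ (G q)
    simp at this
    omega
  have step : ∀ m, m < n → ∀ v ∈ Fil m, dTot G b fc k v = 0 →
      ∃ u ∈ K, v - dTot G b fc k u ∈ Fil (m + 1) := by
    rintro m - v ⟨hv, hvm⟩ hdv
    let u : Q → Finset Q → k := fun q s => if Vld q s ∧ q ≠ b then tog k (· < ·) q (v q) s else 0
    have hu : u ∈ grTot G k (t - 1) := by
      intro q s hqs
      change (if Vld q s ∧ q ≠ b then tog k (· < ·) q (v q) s else 0) = 0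
      split_ifs with hc
      · unfold tog
        split_ifs with hq
        · rfl
        · rw [hv, mul_zero]
          rintro ⟨_, h'⟩
          rw [Finset.card_insert_of_notMem hq] at h'
          exact hqs ⟨hc.1, by push_cast at h'; omega⟩
      · rfl
    have hub : u b = 0 := by
      ext s
      simp [u]
    refine ⟨u, ⟨hu, hub⟩, ?_, ?_⟩
    · refine Submodule.sub_mem _ hv ?_
      simpa using sum_dTot_gr G b fc k h _ u hu
    intro q s hq
    have hlow : ∀ j ∈ G q \ G b, ∀ s', v (fc q ((G q).erase j)) s' = 0 := by
      intro j hj s'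
      apply hvm
      rw [CellData.G_erase G b fc h hj]
      have := Finset.card_erase_add_one (Finset.mem_sdiff.1 hj).1
      omega
    by_cases hval : Vld q s
    swap
    · have : v q s = 0 := hv q s (fun h => hval h.1)
      simp [this, dTot, hval]
    have hcell : dCell G b fc k (fun q' => u q' s) q = 0 := by
      refine Finset.sum_eq_zero fun j hj => ?_
      have : u (fc q ((G q).erase j)) s = 0 := by
        change (if Vld _ s ∧ _ ≠ b then tog k (· < ·) _ (v _) s else 0) = 0
        unfold tog
        rw [hlow j hj]
        simp
      simp only [this, mul_zero]
    change v q s - dTot G b fc k u q s = 0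
    rw [dTot_apply G b fc k u hval, hcell, mul_zero, add_zero, sub_eq_zero]
    by_cases hqb : q = b
    · subst hqb
      rw [hvm q s (by omega), hub]
      simp [dS]
    have e : dS k (u q) s = ∑ w ∈ s, sg k (· < ·) s w * tog k (· < ·) q (v q) (s.erase w) := by
      refine Finset.sum_congr rfl fun w _ => ?_
      congr 1
      exact if_pos ⟨hval.sub le_rfl (Finset.erase_subset _ _), hqb⟩
    rw [e]
    by_cases hqs : q ∈ s
    · rw [tog_mem _ _ _ _ _ hqs hqs]
    · rw [tog_notMem (· < ·) (fun u v h => lt_asymm h) _ _ _ _ le_rfl hqs]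
      · intro j hj
        left
        exact lt_of_le_of_ne (hval.2 j hj) (fun h => hqs (h ▸ hj))
      · have hval' : Vld q (insert q s) := by
          refine ⟨⟨?_, ?_⟩, ?_⟩
          · intro u hu
            rcases Finset.mem_insert.1 hu with rfl | hu
            · rw [h.isMin_iff]; exact hqb
            · exact hval.1.1 u hu
          · rw [Finset.coe_insert]
            exact hval.1.2.insert fun c hc _ => Or.inl (hval.2 c hc)
          · intro u hu
            rcases Finset.mem_insert.1 hu with rfl | hu
            · exact le_rfl
            · exact hval.2 u hu
        have := congrFun (congrFun hdv q) (insert q s)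
        rw [dTot_apply G b fc k v hval'] at this
        have hc0 : dCell G b fc k (fun q' => v q' (insert q s)) q = 0 :=
          Finset.sum_eq_zero fun j hj => by simp only [hlow j hj, mul_zero]
        rw [hc0, mul_zero, add_zero] at this
        exact this
  obtain ⟨u, ⟨hu, hub⟩, hdu⟩ := acyc_of_filtration (dTot G b fc k) (dTot_dTot G b fc k h) K Fil n hM step 0
    (Nat.zero_le _) f ⟨hf, fun q s hq => by
      have : G b = G q := Finset.eq_of_subset_of_card_le (h.mono _ _ (h.hb q)) (by omega)
      have : b = q := h.uniq q b q (h.hb q) le_rfl this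
      rw [← this, hfb]; rfl⟩ hd
  exact ⟨u, hu, hub, hdu⟩

lemma exists_min_chain (h : CellData G b fc) {s : Finset Q} (hs : s ∈ chainsK Q) (hne : s.Nonempty) :
    ∃ m ∈ s, (∀ u ∈ s, m ≤ u) ∧ ∃ a, a ∈ G m \ G b := by
  obtain ⟨m, hm, hmin⟩ := s.exists_minimal hne
  refine ⟨m, hm, ?_, ?_⟩
  · intro u hu
    by_cases hmu : m = u
    · exact hmu.le
    · rcases chain_tri hs hm hu hmu with h | h
      · exact h.le
      · exact hmin hu h.le
  · by_contra hcon
    push Not at hcon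
    have h1 : G m \ G b = ∅ := Finset.eq_empty_of_forall_notMem hcon
    rw [Finset.sdiff_eq_empty_iff_subset] at h1
    have := h.uniq m m b le_rfl (h.hb m) (h1.antisymm (h.mono _ _ (h.hb m)))
    exact hs.1 m hm ((h.isMin_iff m).2 this)

lemma acyc_cell (h : CellData G b fc) (t : ℤ) (f : Q → Finset Q → k) (hf : f ∈ grTot G k t)
    (hd : dTot G b fc k f = 0) (hfb : ∀ q, f q ∅ = 0) :
    ∃ u ∈ grTot G k (t - 1), (∀ q, u q ∅ = 0) ∧ dTot G b fc k u = f := by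
  let K : Submodule k (Q → Finset Q → k) :=
    { carrier := {g | g ∈ grTot G k (t - 1) ∧ ∀ q, g q ∅ = 0}
      add_mem' := by
        rintro g g' ⟨h1, h2⟩ ⟨h3, h4⟩
        refine ⟨Submodule.add_mem _ h1 h3, fun q => ?_⟩
        simp [h2 q, h4 q]
      zero_mem' := ⟨Submodule.zero_mem _, fun _ => rfl⟩
      smul_mem' := by
        rintro c g ⟨h1, h2⟩
        refine ⟨Submodule.smul_mem _ _ h1, fun q => ?_⟩
        simp [h2 q] }
  let Fil : ℕ → Submodule k (Q → Finset Q → k) := fun m =>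
    { carrier := {g | g ∈ grTot G k t ∧ ∀ q s, s.card ≤ m → g q s = 0}
      add_mem' := by
        rintro g g' ⟨h1, h2⟩ ⟨h3, h4⟩
        refine ⟨Submodule.add_mem _ h1 h3, fun q s hq => ?_⟩
        simp [h2 q s hq, h4 q s hq]
      zero_mem' := ⟨Submodule.zero_mem _, fun _ _ _ => rfl⟩
      smul_mem' := by
        rintro c g ⟨h1, h2⟩
        refine ⟨Submodule.smul_mem _ _ h1, fun q s hq => ?_⟩
        simp [h2 q s hq] }
  have hM : Fil (Fintype.card Q) = ⊥ := by
    rw [eq_bot_iff]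
    rintro g ⟨_, hg⟩
    rw [Submodule.mem_bot]
    ext q s
    exact hg q s (Finset.card_le_univ s)
  have hex : ∀ s : Finset Q, ∃ m : Q, ∃ a : Fin n ⊕ Unit, s ∈ chainsK Q → s.Nonempty →
      m ∈ s ∧ (∀ u ∈ s, m ≤ u) ∧ ∃ a', a = Sum.inl a' ∧ a' ∈ G m \ G b := by
    intro s
    by_cases hs : s ∈ chainsK Q ∧ s.Nonempty
    · obtain ⟨m, h1, h2, a, h3⟩ := exists_min_chain G b fc h hs.1 hs.2
      exact ⟨m, Sum.inl a, fun _ _ => ⟨h1, h2, a, rfl, h3⟩⟩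
    · exact ⟨b, Sum.inr (), fun h1 h2 => absurd ⟨h1, h2⟩ hs⟩
  choose m0 a0 hma using hex
  have step : ∀ m, m < Fintype.card Q → ∀ v ∈ Fil m, dTot G b fc k v = 0 →
      ∃ u ∈ K, v - dTot G b fc k u ∈ Fil (m + 1) := by
    rintro m - v ⟨hv, hvm⟩ hdv
    let u : Q → Finset Q → k := fun q s => if Vld q s ∧ s.Nonempty then
      (match a0 s with
      | Sum.inl a => (-1) ^ s.card * tog k (· < ·) a (fun S => v (fc (m0 s) S) s) (G q)
      | Sum.inr _ => 0) else 0
    have hueq : ∀ q s a, Vld q s → s.Nonempty → a0 s = Sum.inl a → u q s = (-1) ^ s.card *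
        tog k (· < ·) a (fun S => v (fc (m0 s) S) s) (G q) := by
      intro q s a h1 h2 h3
      simp only [u, h1, h2, h3, true_and, if_true]
    have hu0 : ∀ q s, ¬ (Vld q s ∧ s.Nonempty) → u q s = 0 := by
      intro q s hc
      simp only [u]
      rw [if_neg hc]
    have hu : u ∈ grTot G k (t - 1) := by
      intro q s hqs
      by_cases hc : Vld q s ∧ s.Nonempty
      swap
      · exact hu0 q s hc
      obtain ⟨hm1, hm2, a, ha, haG⟩ := hma s hc.1.1 hc.2
      rw [hueq q s a hc.1 hc.2 ha]
      rw [Finset.mem_sdiff] at haG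
      unfold tog
      split_ifs with hq
      · simp
      · beta_reduce
        rw [hv]
        · simp
        · rintro ⟨_, h'⟩
          rw [h.G_fc] at h'
          · rw [Finset.card_insert_of_notMem hq] at h'
            exact hqs ⟨hc.1, by push_cast at h'; omega⟩
          · exact (h.mono _ _ (h.hb q)).trans (Finset.subset_insert _ _)
          · exact Finset.insert_subset haG.1 (h.mono _ _ (hc.1.2 _ hm1))
    have hub : ∀ q, u q ∅ = 0 := fun q => hu0 q ∅ (by simp)
    refine ⟨u, ⟨hu, hub⟩, ?_, ?_⟩
    · refine Submodule.sub_mem _ hv ?_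
      simpa using sum_dTot_gr G b fc k h _ u hu
    intro q s hs
    have hlow : ∀ w ∈ s, ∀ q', v q' (s.erase w) = 0 := by
      intro w hw q'
      apply hvm
      have := Finset.card_erase_add_one hw
      omega
    by_cases hval : Vld q s
    swap
    · have : v q s = 0 := hv q s (fun h => hval h.1)
      simp [this, dTot, hval]
    have hS0 : dS k (u q) s = 0 := by
      refine Finset.sum_eq_zero fun w hw => ?_
      by_cases hc : Vld q (s.erase w) ∧ (s.erase w).Nonempty
      · obtain ⟨hm1, hm2, a, ha, haG⟩ := hma _ hc.1.1 hc.2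
        rw [hueq q _ a hc.1 hc.2 ha]
        unfold tog
        simp [hlow w hw]
      · rw [hu0 _ _ hc, mul_zero]
    change v q s - dTot G b fc k u q s = 0
    rw [dTot_apply G b fc k u hval, hS0, zero_add, sub_eq_zero]
    rcases s.eq_empty_or_nonempty with rfl | hne
    · rw [hvm q ∅ (by simp)]
      have : (fun q' => u q' ∅) = 0 := by ext q'; exact hub q'
      rw [this, map_zero]; simp
    obtain ⟨hm1, hm2, a, ha, haG⟩ := hma s hval.1 hne
    have hqm : q ≤ m0 s := hval.2 _ hm1
    have e : dCell G b fc k (fun q' => u q' s) q = (-1) ^ s.card * ∑ j ∈ G q \ G b,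
        sg k (· < ·) (G q) j * tog k (· < ·) a (fun S => v (fc (m0 s) S) s) ((G q).erase j) := by
      rw [Finset.mul_sum]
      refine Finset.sum_congr rfl fun j hj => ?_
      simp only
      rw [hueq _ s a (hval.sub (CellData.erase_le G b fc h hj) le_rfl) hne ha,
        CellData.G_erase G b fc h hj]
      ring
    rw [e, ← mul_assoc, ← pow_add, Even.neg_one_pow ⟨_, rfl⟩, one_mul]
    have hFq : (fun S => v (fc (m0 s) S) s) (G q) = v q s := by
      simp only [h.fc_eq hqm]
    rw [← hFq]
    rw [Finset.mem_sdiff] at haG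
    by_cases haq : a ∈ G q
    · rw [tog_mem _ _ _ _ _ haq (Finset.mem_sdiff.2 ⟨haq, haG.2⟩)]
    · rw [tog_notMem (· < ·) (fun u v h => lt_asymm h) _ _ _ _ Finset.sdiff_subset haq]
      · intro j hj
        refine lt_or_gt_of_ne ?_
        rintro rfl
        exact haq (Finset.mem_sdiff.1 hj).1
      · have hsub1 : G b ⊆ insert a (G q) := (h.mono _ _ (h.hb q)).trans (Finset.subset_insert _ _)
        have hsub2 : insert a (G q) ⊆ G (m0 s) := Finset.insert_subset haG.1 (h.mono _ _ hqm)
        have hle := h.fc_le _ _ hsub1 hsub2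
        have hG := h.G_fc _ _ hsub1 hsub2
        set q' := fc (m0 s) (insert a (G q)) with hq'
        have hval' : Vld q' s := ⟨hval.1, fun u hu => hle.trans (hm2 u hu)⟩
        have h0 := congrFun (congrFun hdv q') s
        rw [dTot_apply G b fc k v hval'] at h0
        have hc0 : dS k (v q') s = 0 :=
          Finset.sum_eq_zero fun j hj => by rw [hlow j hj, mul_zero]
        rw [hc0, zero_add] at h0
        have h1 : dCell G b fc k (fun q' => v q' s) q' = 0 := by
          rcases mul_eq_zero.1 h0 with h0 | h0
          · exact absurd h0 (pow_ne_zero _ (neg_ne_zero.2 one_ne_zero))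
          · exact h0
        rw [← h1]
        simp only [dCell, LinearMap.coe_mk, AddHom.coe_mk]
        rw [hG, Finset.insert_sdiff_of_notMem _ haG.2]
        refine Finset.sum_congr rfl fun j hj => ?_
        rw [← h.fc_sub hle]
        · have : j ∉ G b := by
            rcases Finset.mem_insert.1 hj with rfl | hj
            · exact haG.2
            · exact (Finset.mem_sdiff.1 hj).2
          intro i hi
          refine Finset.mem_erase.2 ⟨?_, hsub1 hi⟩
          rintro rfl; exact this hi
        · rw [hG]; exact Finset.erase_subset _ _
  obtain ⟨u, ⟨hu, hub⟩, hdu⟩ := acyc_of_filtration (dTot G b fc k) (dTot_dTot G b fc k h) K Fil _ hM step 0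
    (Nat.zero_le _) f ⟨hf, fun q s hq => by
      have : s = ∅ := Finset.card_eq_zero.1 (by omega)
      rw [this, hfb]⟩ hd
  exact ⟨u, hu, hub, hdu⟩

/-- Cellular cohomology. -/
abbrev CellCoh (t : ℤ) :=
  ↥(LinearMap.ker (dCell G b fc k) ⊓ grCell G k t) ⧸
    Submodule.comap (LinearMap.ker (dCell G b fc k) ⊓ grCell G k t).subtype
      (Submodule.map (dCell G b fc k) (grCell G k (t - 1)))

theorem cellCoh_equiv (h : CellData G b fc) (t : ℤ) :
    Nonempty (CellCoh G b fc k t ≃ₗ[k] ReducedCoh k Q (t - (G b).card - 1)) := by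
  have h1 := qi_of_acyclic (dTot G b fc k) (dCell G b fc k)
    (LinearMap.pi fun q => (LinearMap.proj (R := k) (φ := fun _ : Finset Q => k) ∅).comp
      (LinearMap.proj (R := k) (φ := fun _ : Q => Finset Q → k) q))
    (grTot G k) (grCell G k) (dTot_dTot G b fc k h) (sum_dTot_gr G b fc k h)
    (by
      intro v
      ext q
      have hv : Vld q ∅ := ⟨⟨by simp, by simp⟩, by simp⟩
      change dTot G b fc k v q ∅ = dCell G b fc k (fun q => v q ∅) q
      rw [dTot_apply G b fc k v hv]
      simp [dS])
    (by
      intro t v hv q hq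
      exact hv q ∅ (fun h => hq (by simpa using h.2)))
    (by
      intro t w hw
      refine ⟨fun q s => if s = ∅ then w q else 0, ?_, ?_⟩
      · intro q s hqs
        simp only
        split_ifs with hs
        · subst hs
          refine hw q fun hq => hqs ⟨⟨⟨by simp, by simp⟩, by simp⟩, by simpa using hq⟩
        · rfl
      · ext q; simp)
    (by
      intro t v hv hd h0
      obtain ⟨u, hu, hu0, hdu⟩ := acyc_cell G b fc k h t v hv hd (fun q => congrFun h0 q)
      exact ⟨u, hu, by ext q; exact hu0 q, hdu⟩) t
  have h2 := qi_of_acyclic (dTot G b fc k) (cDelta k Q (chainsK Q))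
    (LinearMap.proj (R := k) (φ := fun _ : Q => Finset Q → k) b)
    (grTot G k) (fun t => cGraded k Q (chainsK Q) (t - (G b).card - 1))
    (dTot_dTot G b fc k h) (sum_dTot_gr G b fc k h)
    (by
      intro v
      ext s
      have hvld : Vld b s ↔ s ∈ chainsK Q := ⟨fun h => h.1, fun h' => ⟨h', fun u _ => h.hb u⟩⟩
      change (if Vld b s then dS k (v b) s +
        (-1) ^ s.card * dCell G b fc k (fun q' => v q' s) b else 0) = cDelta k Q (chainsK Q) (v b) s
      simp only [cDelta, LinearMap.pi_apply, hvld]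
      split_ifs with hs
      · simp [dCell, dS, sg]
      · rfl)
    (by
      intro t v hv
      rw [cGraded, Submodule.mem_pi]
      intro s _
      split_ifs with hs
      · trivial
      · rw [Submodule.mem_bot]
        refine hv b s fun h' => hs ⟨h'.1.1, by omega⟩)
    (by
      intro t w hw
      rw [cGraded, Submodule.mem_pi] at hw
      refine ⟨fun q s => if q = b then w s else 0, ?_, ?_⟩
      · intro q s hqs
        simp only
        split_ifs with hq
        · subst hq
          have := hw s trivial
          rw [if_neg, Submodule.mem_bot] at this
          · exact this
          · rintro ⟨h1, h2⟩
            exact hqs ⟨⟨h1, fun u _ => h.hb u⟩, by omega⟩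
        · rfl
      · ext s; simp)
    (acyc_order G b fc k h) t
  obtain ⟨e1⟩ := h1
  obtain ⟨e2⟩ := h2
  rw [show t - 1 - ((G b).card : ℤ) - 1 = t - (G b).card - 1 - 1 by ring] at e2
  exact ⟨e1.symm.trans e2⟩

end HelperCell

section HelperFace
set_option linter.unusedSectionVars false
set_option linter.unusedVariables false

variable {P : Type} [Fintype P] [PartialOrder P] [OrderBot P] {n : ℕ}

/-- Support of a face. -/
def sp (x : Fin n → P) (y : P) : Finset (Fin n) := Finset.univ.filter fun i => x i ≤ y

/-- Bundled hypotheses. -/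
structure SP (x : Fin n → P) : Prop where
  hP : IsSimplicialPoset P
  hinj : Function.Injective x
  hatom : ∀ i, IsAtom (x i)
  hsurj : ∀ a : P, IsAtom a → ∃ i, x i = a

variable {x : Fin n → P}

lemma mem_sp {y : P} {i : Fin n} : i ∈ sp x y ↔ x i ≤ y := by simp [sp]

lemma sp_mono {y y' : P} (h : y ≤ y') : sp x y ⊆ sp x y' := by
  intro i hi
  rw [mem_sp] at hi ⊢
  exact hi.trans h

lemma SP.exists_iso (h : SP x) (w : P) : ∃ (m : ℕ) (e : Set.Icc (⊥ : P) w ≃o Finset (Fin m))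
    (c : Fin m → Fin n), Function.Injective c ∧ (∀ i, x i ≤ w → ∃ a, c a = i) ∧
    (∀ a, x (c a) ≤ w) ∧
    ∀ (y : Set.Icc (⊥ : P) w) a, a ∈ e y ↔ x (c a) ≤ y := by
  obtain ⟨m, ⟨e⟩⟩ := h.hP w
  have hbot : e ⟨⊥, le_rfl, bot_le⟩ = ∅ := by
    have : e ⟨⊥, le_rfl, bot_le⟩ ≤ e (e.symm ∅) := by
      rw [e.le_iff_le]
      exact (e.symm ∅).2.1
    rw [e.apply_symm_apply] at this
    exact Finset.subset_empty.1 this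
  have hat : ∀ a : Fin m, IsAtom ((e.symm {a} : Set.Icc (⊥ : P) w) : P) := by
    intro a
    constructor
    · intro h0
      have : e.symm {a} = ⟨⊥, le_rfl, bot_le⟩ := Subtype.ext h0
      have h1 := congrArg e this
      rw [e.apply_symm_apply, hbot] at h1
      simp at h1
    · intro y hy
      have hyw : y ≤ w := hy.le.trans (e.symm {a}).2.2
      have hlt : (⟨y, bot_le, hyw⟩ : Set.Icc (⊥ : P) w) < e.symm {a} := hy
      have h1 : e ⟨y, bot_le, hyw⟩ < {a} := by
        have := e.strictMono hlt
        rwa [e.apply_symm_apply] at this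
      rw [Finset.ssubset_singleton_iff, ← hbot] at h1
      exact congrArg Subtype.val (e.injective h1)
  choose c hc using fun a => h.hsurj _ (hat a)
  refine ⟨m, e, c, ?_, ?_, ?_, ?_⟩
  · intro a a' haa
    have : e.symm {a} = e.symm {a'} := by
      apply Subtype.ext
      rw [← hc, ← hc, haa]
    simpa using e.symm.injective this
  · intro i hi
    have hne : e ⟨x i, bot_le, hi⟩ ≠ ∅ := by
      rw [← hbot]
      intro h1
      exact (h.hatom i).1 (congrArg Subtype.val (e.injective h1))
    obtain ⟨a, ha⟩ := Finset.nonempty_iff_ne_empty.2 hne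
    refine ⟨a, ?_⟩
    have : e.symm {a} ≤ ⟨x i, bot_le, hi⟩ := by
      rw [e.symm_apply_le]
      simpa using ha
    have h2 : x (c a) ≤ x i := by rw [hc]; exact this
    rcases (h.hatom i).le_iff.1 h2 with h3 | h3
    · exact absurd h3 (h.hatom _).1
    · exact h.hinj h3
  · intro a
    rw [hc]; exact (e.symm {a}).2.2
  · intro y a
    rw [hc]
    constructor
    · intro ha
      have : e.symm {a} ≤ y := by
        rw [e.symm_apply_le]; simpa using ha
      exact this
    · intro hle
      have : e.symm {a} ≤ y := hle
      rw [e.symm_apply_le] at this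
      simpa using this

lemma SP.le_of_sp (h : SP x) {w y y' : P} (hy : y ≤ w) (hy' : y' ≤ w) (hs : sp x y ⊆ sp x y') :
    y ≤ y' := by
  obtain ⟨m, e, c, -, -, -, h4⟩ := h.exists_iso w
  have : e ⟨y, bot_le, hy⟩ ≤ e ⟨y', bot_le, hy'⟩ := by
    intro a ha
    rw [h4] at ha ⊢
    exact mem_sp.1 (hs (mem_sp.2 ha))
  rwa [e.le_iff_le] at this

lemma SP.uniq (h : SP x) {w y y' : P} (hy : y ≤ w) (hy' : y' ≤ w) (hs : sp x y = sp x y') :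
    y = y' :=
  le_antisymm (h.le_of_sp hy hy' hs.subset) (h.le_of_sp hy' hy hs.symm.subset)

lemma SP.exists_face (h : SP x) (w : P) (S : Finset (Fin n)) (hS : S ⊆ sp x w) :
    ∃ y ≤ w, sp x y = S := by
  obtain ⟨m, e, c, h1, h2, h3, h4⟩ := h.exists_iso w
  refine ⟨e.symm (Finset.univ.filter fun a => c a ∈ S), (e.symm _).2.2, ?_⟩
  have key := h4 (e.symm (Finset.univ.filter fun a => c a ∈ S))
  simp only [e.apply_symm_apply, Finset.mem_filter, Finset.mem_univ, true_and] at key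
  ext i
  rw [mem_sp]
  constructor
  · intro hi
    obtain ⟨a, rfl⟩ := h2 i (hi.trans (e.symm _).2.2)
    exact (key a).2 hi
  · intro hi
    obtain ⟨a, rfl⟩ := h2 i (mem_sp.1 (hS hi))
    exact (key a).1 hi

/-- The face of `w` with support `S`. -/
def fce (x : Fin n → P) (w : P) (S : Finset (Fin n)) : P :=
  if h : ∃ y, y ≤ w ∧ sp x y = S then h.choose else ⊥

lemma SP.fce_le (h : SP x) {w : P} {S : Finset (Fin n)} (hS : S ⊆ sp x w) : fce x w S ≤ w := by
  have := h.exists_face w S hS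
  rw [fce, dif_pos this]
  exact this.choose_spec.1

lemma SP.sp_fce (h : SP x) {w : P} {S : Finset (Fin n)} (hS : S ⊆ sp x w) : sp x (fce x w S) = S := by
  have := h.exists_face w S hS
  rw [fce, dif_pos this]
  exact this.choose_spec.2

lemma SP.sp_bot (h : SP x) : sp x (⊥ : P) = ∅ := by
  ext i
  simp [mem_sp, (h.hatom i).1]

lemma SP.sp_atom (h : SP x) (j : Fin n) : sp x (x j) = {j} := by
  ext i
  rw [mem_sp, Finset.mem_singleton]
  constructor
  · intro hi
    rcases (h.hatom j).le_iff.1 hi with h3 | h3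
    · exact absurd h3 (h.hatom _).1
    · exact h.hinj h3
  · rintro rfl; exact le_rfl

lemma SP.sp_mub (h : SP x) {a b z : P} (hz : z ∈ MUB a b) : sp x z = sp x a ∪ sp x b := by
  have ha : a ≤ z := hz.1 (by simp)
  have hb : b ≤ z := hz.1 (by simp)
  have hS : sp x a ∪ sp x b ⊆ sp x z := Finset.union_subset (sp_mono ha) (sp_mono hb)
  have := hz.2 (fce x z (sp x a ∪ sp x b)) (by
    intro u hu
    rcases hu with rfl | rfl
    · exact h.le_of_sp ha (h.fce_le hS) (by rw [h.sp_fce hS]; exact Finset.subset_union_left)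
    · exact h.le_of_sp hb (h.fce_le hS) (by rw [h.sp_fce hS]; exact Finset.subset_union_right))
    (h.fce_le hS)
  rw [← this, h.sp_fce hS]

lemma SP.mem_mub (h : SP x) {a b w : P} (ha : a ≤ w) (hb : b ≤ w) :
    fce x w (sp x a ∪ sp x b) ∈ MUB a b := by
  have hS : sp x a ∪ sp x b ⊆ sp x w := Finset.union_subset (sp_mono ha) (sp_mono hb)
  constructor
  · intro u hu
    rcases hu with rfl | rfl
    · exact h.le_of_sp ha (h.fce_le hS) (by rw [h.sp_fce hS]; exact Finset.subset_union_left)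
    · exact h.le_of_sp hb (h.fce_le hS) (by rw [h.sp_fce hS]; exact Finset.subset_union_right)
  · intro z' hz' hle
    have ha' : a ≤ z' := hz' (by simp)
    have hb' : b ≤ z' := hz' (by simp)
    refine le_antisymm hle (h.le_of_sp (h.fce_le hS) (hle.trans (h.fce_le hS)) ?_)
    rw [h.sp_fce hS]
    exact Finset.union_subset (sp_mono ha') (sp_mono hb')

lemma SP.glb (h : SP x) {a b w m : P} (ha : a ≤ w) (hb : b ≤ w)
    (hm : IsGLB {a, b} m) : sp x m = sp x a ∩ sp x b := by
  have h1 : m ≤ a := hm.1 (by simp)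
  have h2 : m ≤ b := hm.1 (by simp)
  refine (Finset.subset_inter (sp_mono h1) (sp_mono h2)).antisymm ?_
  intro i hi
  rw [Finset.mem_inter, mem_sp, mem_sp] at hi
  rw [mem_sp]
  apply hm.2
  intro u hu
  rcases hu with rfl | rfl
  · exact hi.1
  · exact hi.2

lemma SP.exists_glb (h : SP x) {a b w : P} (ha : a ≤ w) (hb : b ≤ w) :
    ∃ m, IsGLB {a, b} m := by
  have hS : sp x a ∩ sp x b ⊆ sp x w := Finset.inter_subset_left.trans (sp_mono ha)
  refine ⟨fce x w (sp x a ∩ sp x b), ?_, ?_⟩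
  · intro u hu
    rcases hu with rfl | rfl
    · exact h.le_of_sp (h.fce_le hS) ha (by rw [h.sp_fce hS]; exact Finset.inter_subset_left)
    · exact h.le_of_sp (h.fce_le hS) hb (by rw [h.sp_fce hS]; exact Finset.inter_subset_right)
  · intro c hc
    have h1 : c ≤ a := hc (by simp)
    have h2 : c ≤ b := hc (by simp)
    refine h.le_of_sp (h1.trans ha) (h.fce_le hS) ?_
    rw [h.sp_fce hS]
    exact Finset.subset_inter (sp_mono h1) (sp_mono h2)

variable (k : Type) [Field k]

lemma fv_rel0 {w y : P} (hwy : upperBounds {w, y} = ∅) : fv P k w * fv P k y = 0 := by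
  unfold fv
  rw [← map_mul, Ideal.Quotient.eq_zero_iff_mem]
  exact Ideal.subset_span (Or.inl (Or.inl ⟨w, y, hwy, rfl⟩))

lemma fv_rel {w y m : P} (hwy : (upperBounds {w, y}).Nonempty) (hm : IsGLB {w, y} m) :
    fv P k w * fv P k y = fv P k m * ∑ z ∈ (Set.toFinite (MUB w y)).toFinset, fv P k z := by
  unfold fv
  rw [← map_mul, ← map_sum, ← map_mul, Ideal.Quotient.eq]
  exact Ideal.subset_span (Or.inl (Or.inr ⟨w, y, m, hwy, hm, rfl⟩))

lemma fv_bot : fv P k (⊥ : P) = 1 := by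
  unfold fv
  rw [← map_one (Ideal.Quotient.mk (faceIdeal P k)), Ideal.Quotient.eq]
  exact Ideal.subset_span (Or.inr rfl)

lemma SP.fv_zero (h : SP x) {w y z : P} (hy : y ≤ w) (hs : sp x y = sp x z) (hne : z ≠ y) :
    fv P k w * fv P k z = 0 := by
  apply fv_rel0
  rw [Set.eq_empty_iff_forall_notMem]
  intro u hu
  have h1 : w ≤ u := hu (by simp)
  have h2 : z ≤ u := hu (by simp)
  exact hne (h.uniq h2 (hy.trans h1) hs.symm)

lemma SP.fv_mul_face (h : SP x) (w : P) (S : Finset (Fin n)) (hS : S ⊆ sp x w) :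
    fv P k w * fv P k (fce x w S) = fv P k w * ∏ i ∈ S, fv P k (x i) := by
  induction S using Finset.induction_on with
  | empty =>
    have : fce x w ∅ = ⊥ := h.uniq (h.fce_le hS) bot_le (by rw [h.sp_fce hS, h.sp_bot])
    rw [this, fv_bot]; simp
  | insert a S ha ih =>
    have hS' : S ⊆ sp x w := (Finset.subset_insert _ _).trans hS
    have haw : x a ≤ w := mem_sp.1 (hS (Finset.mem_insert_self _ _))
    have hyw := h.fce_le hS'
    rw [Finset.prod_insert ha, mul_left_comm, ← ih hS', mul_left_comm, fv_rel k (w := x a) (y := fce x w S) (m := ⊥), fv_bot, one_mul,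
      Finset.mul_sum, Finset.sum_eq_single (fce x w (insert a S))]
    · intro z hz hne
      rw [Set.Finite.mem_toFinset] at hz
      refine h.fv_zero k (h.fce_le hS) ?_ hne
      rw [h.sp_fce hS, h.sp_mub hz, h.sp_fce hS', h.sp_atom]
      rfl
    · intro hn
      exfalso; apply hn
      rw [Set.Finite.mem_toFinset]
      have := h.mem_mub haw hyw
      rwa [h.sp_fce hS', h.sp_atom] at this
    · refine ⟨w, ?_⟩
      intro u hu
      rcases hu with rfl | rfl
      · exact haw
      · exact hyw
    · refine ⟨by intro u _; exact bot_le, ?_⟩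
      intro c hc
      have h1 : c ≤ x a := hc (by simp)
      have h2 : c ≤ fce x w S := hc (by simp)
      rcases (h.hatom a).le_iff.1 h1 with h3 | h3
      · exact h3.le
      · exfalso
        rw [h3] at h2
        have := sp_mono (x := x) h2
        rw [h.sp_fce hS', h.sp_atom] at this
        exact ha (by simpa using this)

lemma SP.fv_mul_le (h : SP x) {w y : P} (hy : y ≤ w) :
    fv P k w * fv P k y = fv P k w * ∏ i ∈ sp x y, fv P k (x i) := by
  rw [← h.fv_mul_face k w _ (sp_mono hy)]
  congr 2
  exact h.uniq hy (h.fce_le (sp_mono hy)) (h.sp_fce (sp_mono hy)).symm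

/-- The spanning elements. -/
def emn (x : Fin n → P) (w : P) (γ : Fin n → ℕ) : FaceRing P k := fv P k w * ∏ i, fv P k (x i) ^ γ i

/-- degree of a monomial -/
def dg (x : Fin n → P) (σ : P →₀ ℕ) (j : Fin n) : ℕ := ∑ y, if x j ≤ y then σ y else 0

lemma SP.span_mono (h : SP x) (σ : P →₀ ℕ) :
    Ideal.Quotient.mk (faceIdeal P k) (monomial σ (1 : k)) ∈ Submodule.span k
      {r | ∃ w γ, (∀ i, γ i ≠ 0 → i ∈ sp x w) ∧
        (∀ i, (if i ∈ sp x w then 1 else 0) + γ i = dg x σ i) ∧ r = emn k x w γ} := by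
  induction hN : σ.degree generalizing σ with
  | zero =>
    rw [Finsupp.degree_eq_zero_iff] at hN
    subst hN
    refine Submodule.subset_span ⟨⊥, 0, by simp, ?_, ?_⟩
    · intro i; simp [h.sp_bot, dg]
    · simp [emn, fv_bot]
  | succ N ih =>
    have hne : σ ≠ 0 := by rintro rfl; simp at hN
    obtain ⟨y, hy⟩ := Finsupp.support_nonempty_iff.2 hne
    have hle : Finsupp.single y 1 ≤ σ := by
      rw [Finsupp.single_le_iff]
      exact Nat.one_le_iff_ne_zero.2 (Finsupp.mem_support_iff.1 hy)
    obtain ⟨τ, rfl⟩ : ∃ τ, σ = τ + Finsupp.single y 1 := ⟨σ - Finsupp.single y 1, (tsub_add_cancel_of_le hle).symm⟩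
    have hτ : τ.degree = N := by simpa using hN
    have hd : ∀ i, dg x (τ + Finsupp.single y 1) i = dg x τ i + if i ∈ sp x y then 1 else 0 := by
      intro i
      simp only [dg, Finsupp.add_apply, mem_sp]
      rw [show (if x i ≤ y then 1 else 0) = ∑ y', if x i ≤ y' then (Finsupp.single y 1 : P →₀ ℕ) y' else 0 by
        rw [Finset.sum_eq_single y]
        · simp
        · intro b _ hb
          simp [hb.symm]
        · simp]
      rw [← Finset.sum_add_distrib]
      exact Finset.sum_congr rfl fun y' _ => by split_ifs <;> simp
    have hm : Ideal.Quotient.mk (faceIdeal P k) (monomial (τ + Finsupp.single y 1) (1 : k))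
        = fv P k y * Ideal.Quotient.mk (faceIdeal P k) (monomial τ (1 : k)) := by
      unfold fv
      rw [← map_mul, add_comm, X, monomial_mul, one_mul]
    rw [hm]
    have := ih τ hτ
    refine Submodule.span_induction (p := fun r _ => fv P k y * r ∈ Submodule.span k
      {r | ∃ w γ, (∀ i, γ i ≠ 0 → i ∈ sp x w) ∧
        (∀ i, (if i ∈ sp x w then 1 else 0) + γ i = dg x (τ + Finsupp.single y 1) i) ∧ r = emn k x w γ})
      ?_ ?_ ?_ ?_ this
    · rintro r ⟨w, γ, hγ, hdeg, rfl⟩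
      have e0 : fv P k y * emn k x w γ = fv P k w * fv P k y * ∏ i, fv P k (x i) ^ γ i := by
        unfold emn; ring
      rw [e0]
      rcases Set.eq_empty_or_nonempty (upperBounds {w, y}) with hub | ⟨u, hu⟩
      · rw [fv_rel0 k hub, zero_mul]; exact Submodule.zero_mem _
      · have hwu : w ≤ u := hu (by simp)
        have hyu : y ≤ u := hu (by simp)
        obtain ⟨m, hm⟩ := h.exists_glb hwu hyu
        rw [fv_rel k ⟨u, hu⟩ hm, Finset.mul_sum, Finset.sum_mul]
        refine Submodule.sum_mem _ fun z hz => ?_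
        rw [Set.Finite.mem_toFinset] at hz
        have hmw : m ≤ w := hm.1 (by simp)
        have hwz : w ≤ z := hz.1 (by simp)
        rw [mul_comm (fv P k m), h.fv_mul_le k (hmw.trans hwz)]
        refine Submodule.subset_span ⟨z, fun i => γ i + if i ∈ sp x m then 1 else 0, ?_, ?_, ?_⟩
        · intro i hi
          by_cases him : i ∈ sp x m
          · exact sp_mono (hmw.trans hwz) him
          · simp only [him, if_false, add_zero] at hi
            exact sp_mono hwz (hγ i hi)
        · intro i
          rw [hd, ← hdeg, h.sp_mub hz, h.glb hwu hyu hm]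
          simp only [Finset.mem_union, Finset.mem_inter]
          by_cases h1 : i ∈ sp x w <;> by_cases h2 : i ∈ sp x y <;> simp [h1, h2] <;> ring
        · unfold emn
          rw [mul_assoc]
          congr 1
          simp only [pow_add, Finset.prod_mul_distrib, pow_ite, pow_one, pow_zero]
          rw [mul_comm]
          congr 1
          rw [Finset.prod_ite_mem, Finset.univ_inter]
    · rw [mul_zero]; exact Submodule.zero_mem _
    · intro a b _ _ ha hb
      rw [mul_add]; exact Submodule.add_mem _ ha hb
    · intro c a _ ha
      rw [mul_smul_comm]; exact Submodule.smul_mem _ _ ha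


/-- Restriction to a face, before passing to the quotient. -/
def phi0 (x : Fin n → P) (w : P) : MvPolynomial P k →ₐ[k] MvPolynomial (Fin n) k :=
  aeval fun y => if y ≤ w then ∏ i ∈ sp x y, X i else 0

lemma phi0_X (w y : P) : phi0 k x w (X y) = if y ≤ w then ∏ i ∈ sp x y, X i else 0 := by
  simp [phi0]

lemma SP.phi0_ideal (h : SP x) (w : P) (f : MvPolynomial P k) (hf : f ∈ faceIdeal P k) :
    phi0 k x w f = 0 := by
  have hle : faceIdeal P k ≤ RingHom.ker (phi0 k x w) := by
    unfold faceIdeal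
    rw [Ideal.span_le]
    rintro f ((⟨a, b, hab, rfl⟩ | ⟨a, b, m, hab, hm, rfl⟩) | hf)
    · simp only [SetLike.mem_coe, RingHom.mem_ker, RingHom.coe_coe, map_mul, phi0_X]
      by_cases ha : a ≤ w
      · by_cases hb : b ≤ w
        · exfalso
          have : w ∈ upperBounds {a, b} := by
            intro u hu
            rcases hu with rfl | rfl
            · exact ha
            · exact hb
          rw [hab] at this
          exact this
        · simp [hb]
      · simp [ha]
    · simp only [SetLike.mem_coe, RingHom.mem_ker, RingHom.coe_coe, map_mul, map_sub, map_sum, phi0_X]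
      by_cases hw : a ≤ w ∧ b ≤ w
      · have hS : sp x a ∪ sp x b ⊆ sp x w := Finset.union_subset (sp_mono hw.1) (sp_mono hw.2)
        have hma : m ≤ a := hm.1 (by simp)
        rw [Finset.sum_eq_single (fce x w (sp x a ∪ sp x b)), if_pos hw.1, if_pos hw.2,
          if_pos (hma.trans hw.1), if_pos (h.fce_le hS), h.sp_fce hS, h.glb hw.1 hw.2 hm,
          sub_eq_zero, mul_comm (∏ i ∈ sp x a ∩ sp x b, _), Finset.prod_union_inter]
        · intro z hz hne
          rw [Set.Finite.mem_toFinset] at hz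
          rw [if_neg]
          intro hzw
          exact hne (h.uniq hzw (h.fce_le hS) (by rw [h.sp_mub hz, h.sp_fce hS]))
        · intro hn
          exfalso; apply hn
          rw [Set.Finite.mem_toFinset]
          exact h.mem_mub hw.1 hw.2
      · rw [Finset.sum_eq_zero, mul_zero, sub_zero]
        · by_cases ha : a ≤ w
          · rw [if_neg (fun hb => hw ⟨ha, hb⟩), mul_zero]
          · rw [if_neg ha, zero_mul]
        · intro z hz
          rw [Set.Finite.mem_toFinset] at hz
          rw [if_neg]
          intro hzw
          exact hw ⟨(hz.1 (by simp)).trans hzw, (hz.1 (by simp)).trans hzw⟩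
    · rw [Set.mem_singleton_iff] at hf
      subst hf
      simp only [SetLike.mem_coe, RingHom.mem_ker, RingHom.coe_coe, map_sub, phi0_X, map_one]
      rw [if_pos bot_le, h.sp_bot]
      simp
  exact hle hf

/-- Restriction to a face. -/
def phi (h : SP x) (w : P) : FaceRing P k →ₐ[k] MvPolynomial (Fin n) k :=
  Ideal.Quotient.liftₐ (faceIdeal P k) (phi0 k x w) (h.phi0_ideal k w)

lemma phi_mk (h : SP x) (w : P) (f : MvPolynomial P k) :
    phi k h w (Ideal.Quotient.mk _ f) = phi0 k x w f := rfl

/-- degree as a finsupp -/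
def dgF (x : Fin n → P) (σ : P →₀ ℕ) : Fin n →₀ ℕ := Finsupp.equivFunOnFinite.symm (dg x σ)

lemma phi_monomial (h : SP x) (w : P) (σ : P →₀ ℕ) :
    phi k h w (Ideal.Quotient.mk _ (monomial σ 1)) =
      if ∀ y ∈ σ.support, y ≤ w then monomial (dgF x σ) 1 else 0 := by
  rw [phi_mk, phi0, aeval_monomial, map_one, one_mul]
  split_ifs with hc
  · rw [monomial_eq, C_1, one_mul]
    have e1 : (σ.prod fun y e => (if y ≤ w then ∏ i ∈ sp x y, (X i : MvPolynomial (Fin n) k) else 0) ^ e)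
        = ∏ y, ∏ i, if x i ≤ y then (X i : MvPolynomial (Fin n) k) ^ σ y else 1 := by
      rw [Finsupp.prod_of_support_subset σ (Finset.subset_univ _) _ (fun _ _ => pow_zero _)]
      refine Finset.prod_congr rfl fun y _ => ?_
      by_cases hy : y ∈ σ.support
      · rw [if_pos (hc y hy), ← Finset.prod_pow, sp, Finset.prod_filter]
      · rw [Finsupp.notMem_support_iff.1 hy]
        simp
    rw [e1, Finset.prod_comm, Finsupp.prod_fintype _ _ (fun _ => pow_zero _)]
    refine Finset.prod_congr rfl fun i _ => ?_
    change _ = X i ^ (dg x σ i)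
    rw [dg, ← Finset.prod_pow_eq_pow_sum]
    refine Finset.prod_congr rfl fun y _ => ?_
    split_ifs <;> simp
  · push Not at hc
    obtain ⟨y, hy, hyw⟩ := hc
    refine Finset.prod_eq_zero hy ?_
    simp only
    rw [if_neg hyw, zero_pow (Finsupp.mem_support_iff.1 hy)]

/-- degree vector to finsupp -/
def toF (β : Fin n → ℤ) : Fin n →₀ ℕ := Finsupp.equivFunOnFinite.symm fun i => (β i).toNat

/-- Coordinate functional. -/
def cf (h : SP x) (w : P) (β : Fin n → ℤ) : FaceRing P k →ₗ[k] k :=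
  (lcoeff k (toF β)).comp (phi k h w).toLinearMap

lemma cf_apply (h : SP x) (w : P) (β : Fin n → ℤ) (r : FaceRing P k) :
    cf k h w β r = coeff (toF β) (phi k h w r) := rfl

lemma cf_monomial (h : SP x) (w : P) (β : Fin n → ℤ) (σ : P →₀ ℕ) (hσ : ∀ j, (dg x σ j : ℤ) = β j) :
    cf k h w β (Ideal.Quotient.mk _ (monomial σ 1)) = if ∀ y ∈ σ.support, y ≤ w then 1 else 0 := by
  have : toF β = dgF x σ := by
    ext i
    simp [toF, dgF, ← hσ]
  rw [cf_apply, phi_monomial, this]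
  split_ifs
  · rw [coeff_monomial, if_pos rfl]
  · rw [coeff_zero]

lemma facePiece_eq (β : Fin n → ℤ) : facePiece P k n x β = Submodule.span k
    {r | ∃ σ : P →₀ ℕ, (∀ j, (dg x σ j : ℤ) = β j) ∧
      r = Ideal.Quotient.mk _ (monomial σ (1 : k))} := by
  have : ∀ (σ : P →₀ ℕ) j, (∑ y ∈ σ.support, if x j ≤ y then (σ y : ℤ) else 0) = dg x σ j := by
    intro σ j
    rw [dg]
    push_cast
    refine Finset.sum_subset (Finset.subset_univ _) ?_
    intro y _ hy
    rw [Finsupp.notMem_support_iff.1 hy]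
    simp
  unfold facePiece
  simp only [this]

lemma facePiece_neg (β : Fin n → ℤ) (j : Fin n) (hj : β j < 0) : facePiece P k n x β = ⊥ := by
  rw [facePiece_eq, Submodule.span_eq_bot]
  rintro r ⟨σ, hσ, -⟩
  have := hσ j
  omega

lemma le_of_mem_support (σ : P →₀ ℕ) {y : P} (hy : y ∈ σ.support) {i : Fin n} (hi : x i ≤ y) :
    0 < dg x σ i := by
  have h1 : σ y ≤ dg x σ i := by
    have := Finset.single_le_sum (f := fun y => if x i ≤ y then σ y else 0) (fun _ _ => Nat.zero_le _)
      (Finset.mem_univ y)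
    simpa [hi, dg] using this
  exact lt_of_lt_of_le (Nat.pos_of_ne_zero (Finsupp.mem_support_iff.1 hy)) h1

lemma cf_sub (h : SP x) (β : Fin n → ℤ) {w w' : P} (hw : w' ≤ w) (hs : ∀ j, 0 < β j → x j ≤ w')
    {r : FaceRing P k} (hr : r ∈ facePiece P k n x β) : cf k h w β r = cf k h w' β r := by
  rw [facePiece_eq] at hr
  refine Submodule.span_induction (p := fun r _ => cf k h w β r = cf k h w' β r) ?_ ?_ ?_ ?_ hr
  · rintro r ⟨σ, hσ, rfl⟩
    rw [cf_monomial k h w β σ hσ, cf_monomial k h w' β σ hσ]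
    have : (∀ y ∈ σ.support, y ≤ w) ↔ (∀ y ∈ σ.support, y ≤ w') := by
      constructor
      · intro hy y hys
        refine h.le_of_sp (hy y hys) hw ?_
        intro i hi
        rw [mem_sp] at hi ⊢
        have := le_of_mem_support σ hys hi
        exact hs i (by rw [← hσ]; exact_mod_cast this)
      · intro hy y hys
        exact (hy y hys).trans hw
    simp only [this]
  · simp
  · intro a b _ _ ha hb; rw [map_add, map_add, ha, hb]
  · intro c a _ ha; rw [map_smul, map_smul, ha]

lemma dg_add (σ τ : P →₀ ℕ) (j : Fin n) : dg x (σ + τ) j = dg x σ j + dg x τ j := by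
  simp only [dg, Finsupp.add_apply]
  rw [← Finset.sum_add_distrib]
  exact Finset.sum_congr rfl fun y' _ => by split_ifs <;> simp

lemma dg_single (y : P) (a : ℕ) (j : Fin n) :
    dg x (Finsupp.single y a) j = if x j ≤ y then a else 0 := by
  unfold dg
  rw [Finset.sum_eq_single y]
  · simp
  · intro b _ hb
    simp [hb.symm]
  · simp

lemma fv_pow_eq (y : P) (l : ℕ) : fv P k y ^ l =
    Ideal.Quotient.mk _ (monomial (Finsupp.single y l) (1 : k)) := by
  unfold fv
  rw [← map_pow, X_pow_eq_monomial]

lemma facePiece_mul (h : SP x) (β : Fin n → ℤ) (j : Fin n) (l : ℕ)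
    {r : FaceRing P k} (hr : r ∈ facePiece P k n x β) :
    fv P k (x j) ^ l * r ∈ facePiece P k n x (fun i => β i + if i = j then (l : ℤ) else 0) := by
  rw [facePiece_eq] at hr ⊢
  refine Submodule.span_induction (p := fun r _ => fv P k (x j) ^ l * r ∈ Submodule.span k
    {r | ∃ σ : P →₀ ℕ, (∀ i, (dg x σ i : ℤ) = β i + if i = j then (l : ℤ) else 0) ∧
      r = Ideal.Quotient.mk _ (monomial σ (1 : k))}) ?_ ?_ ?_ ?_ hr
  · rintro r ⟨σ, hσ, rfl⟩
    refine Submodule.subset_span ⟨Finsupp.single (x j) l + σ, ?_, ?_⟩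
    · intro i
      rw [dg_add, dg_single]
      have : x i ≤ x j ↔ i = j := by
        rw [← mem_sp (x := x), h.sp_atom, Finset.mem_singleton]
      simp only [this]
      push_cast
      rw [hσ, add_comm]
    · rw [fv_pow_eq, ← map_mul, monomial_mul, one_mul]
  · rw [mul_zero]; exact Submodule.zero_mem _
  · intro a b _ _ ha hb
    rw [mul_add]; exact Submodule.add_mem _ ha hb
  · intro c a _ ha
    rw [mul_smul_comm]; exact Submodule.smul_mem _ _ ha

lemma cf_mul (h : SP x) (β : Fin n → ℤ) (j : Fin n) (l : ℕ) (w : P) (hj : x j ≤ w) (hβ : 0 ≤ β j)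
    (r : FaceRing P k) :
    cf k h w (fun i => β i + if i = j then (l : ℤ) else 0) (fv P k (x j) ^ l * r) = cf k h w β r := by
  rw [cf_apply, cf_apply, map_mul, map_pow]
  have e1 : phi k h w (fv P k (x j)) = X j := by
    rw [fv, phi_mk, phi0_X, if_pos hj, h.sp_atom]
    simp
  have e2 : toF (fun i => β i + if i = j then (l : ℤ) else 0) = Finsupp.single j l + toF β := by
    ext i
    simp only [toF, Finsupp.equivFunOnFinite_symm_apply_apply, Finsupp.add_apply]
    by_cases hij : i = j
    · subst hij
      simp
      omega
    · simp [hij]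
  rw [e1, e2, X_pow_eq_monomial, coeff_monomial_mul, one_mul]

/-- Exponent vector of the spanning element. -/
def sgw (x : Fin n → P) (w : P) (γ : Fin n → ℕ) : P →₀ ℕ :=
  Finsupp.single w 1 + ∑ i, Finsupp.single (x i) (γ i)

lemma emn_eq (w : P) (γ : Fin n → ℕ) :
    emn k x w γ = Ideal.Quotient.mk _ (monomial (sgw x w γ) (1 : k)) := by
  rw [emn, sgw, ← one_mul (1 : k), ← monomial_mul, map_mul]
  congr 1
  rw [show (monomial (∑ i, Finsupp.single (x i) (γ i)) (1 : k)) =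
    ∏ i, monomial (Finsupp.single (x i) (γ i)) (1 : k) by
      rw [monomial_sum_one], map_prod]
  exact Finset.prod_congr rfl fun i _ => fv_pow_eq k _ _

lemma dg_sgw (h : SP x) (w : P) (γ : Fin n → ℕ) (j : Fin n) :
    dg x (sgw x w γ) j = (if x j ≤ w then 1 else 0) + γ j := by
  rw [sgw, dg_add, dg_single]
  congr 1
  have : ∀ s : Finset (Fin n), dg x (∑ i ∈ s, Finsupp.single (x i) (γ i)) j = if j ∈ s then γ j else 0 := by
    intro s
    induction s using Finset.induction_on with
    | empty => simp [dg]
    | insert a s ha ih =>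
      rw [Finset.sum_insert ha, dg_add, dg_single, ih]
      have : x j ≤ x a ↔ j = a := by
        rw [← mem_sp (x := x), h.sp_atom, Finset.mem_singleton]
      simp only [this]
      by_cases hja : j = a
      · subst hja; simp [ha]
      · simp [hja]
  simpa using this Finset.univ

lemma cf_emn (h : SP x) (β : Fin n → ℤ) (hβ : ∀ i, 0 ≤ β i) (v w : P)
    (hv : ∀ i, x i ≤ v ↔ 0 < β i) (hw : ∀ i, x i ≤ w ↔ 0 < β i) :
    cf k h v β (emn k x w fun i => (β i).toNat - 1) = if w = v then 1 else 0 := by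
  rw [emn_eq, cf_monomial]
  · have : (∀ y ∈ (sgw x w fun i => (β i).toNat - 1).support, y ≤ v) ↔ w = v := by
      constructor
      · intro hy
        have hwv : w ≤ v := by
          apply hy
          simp [sgw]
        refine h.uniq hwv le_rfl ?_
        ext i
        rw [mem_sp, mem_sp, hv, hw]
      · rintro rfl y hy
        rw [sgw, Finsupp.mem_support_iff, Finsupp.add_apply] at hy
        by_cases hyw : w = y
        · exact hyw.ge
        · rw [Finsupp.single_apply, if_neg hyw, zero_add, Finsupp.finsetSum_apply] at hy
          obtain ⟨i, -, hi⟩ := Finset.exists_ne_zero_of_sum_ne_zero hy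
          rw [Finsupp.single_apply] at hi
          split_ifs at hi with hxi
          · rw [← hxi, hv]
            omega
          · exact absurd rfl hi
    simp only [this]
  · intro j
    rw [dg_sgw h]
    have := hβ j
    have := hw j
    split_ifs with hc
    · rw [this] at hc; omega
    · rw [this] at hc; omega

lemma emn_mem (h : SP x) (β : Fin n → ℤ) (hβ : ∀ i, 0 ≤ β i) (w : P)
    (hw : ∀ i, x i ≤ w ↔ 0 < β i) :
    (emn k x w fun i => (β i).toNat - 1) ∈ facePiece P k n x β := by
  rw [facePiece_eq, emn_eq]
  refine Submodule.subset_span ⟨_, ?_, rfl⟩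
  intro j
  rw [dg_sgw h]
  have := hβ j
  have := hw j
  split_ifs with hc
  · rw [this] at hc; omega
  · rw [this] at hc; omega

lemma facePiece_lift (h : SP x) (β : Fin n → ℤ) (hβ : ∀ i, 0 ≤ β i) (c : P → k) :
    ∃ r ∈ facePiece P k n x β, ∀ v, (∀ i, x i ≤ v ↔ 0 < β i) → cf k h v β r = c v := by
  refine ⟨∑ w : {w : P // ∀ i, x i ≤ w ↔ 0 < β i}, c w • emn k x w.1 fun i => (β i).toNat - 1, ?_, ?_⟩
  · exact Submodule.sum_mem _ fun w _ => Submodule.smul_mem _ _ (emn_mem k h β hβ w.1 w.2)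
  · intro v hv
    rw [map_sum, Finset.sum_eq_single ⟨v, hv⟩]
    · rw [map_smul, cf_emn k h β hβ v v hv hv]; simp
    · intro w _ hne
      rw [map_smul, cf_emn k h β hβ v w.1 hv w.2, if_neg, smul_zero]
      intro heq; exact hne (Subtype.ext heq)
    · simp

lemma facePiece_inj (h : SP x) (β : Fin n → ℤ) (hβ : ∀ i, 0 ≤ β i) {r : FaceRing P k}
    (hr : r ∈ facePiece P k n x β)
    (h0 : ∀ v, (∀ i, x i ≤ v ↔ 0 < β i) → cf k h v β r = 0) : r = 0 := by
  have hle : facePiece P k n x β ≤ Submodule.span k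
      (Set.range fun w : {w : P // ∀ i, x i ≤ w ↔ 0 < β i} => emn k x w.1 fun i => (β i).toNat - 1) := by
    rw [facePiece_eq, Submodule.span_le]
    rintro r ⟨σ, hσ, rfl⟩
    refine Submodule.span_mono ?_ (h.span_mono k σ)
    rintro r ⟨w, γ, hγ, hdeg, rfl⟩
    refine ⟨⟨w, fun i => ?_⟩, ?_⟩
    · have h1 := hσ i
      have h2 := hdeg i
      have h3 := hγ i
      rw [← mem_sp (x := x)]
      by_cases hi : i ∈ sp x w
      · simp only [hi, if_true] at h2
        simp only [hi, true_iff]; omega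
      · simp only [hi, if_false] at h2
        simp only [hi, false_iff]
        have : γ i = 0 := by
          by_contra hne; exact hi (h3 hne)
        omega
    · simp only
      congr 1
      ext i
      have h1 := hσ i
      have h2 := hdeg i
      have h3 := hγ i
      by_cases hi : i ∈ sp x w
      · simp only [hi, if_true] at h2
        omega
      · simp only [hi, if_false] at h2
        have : γ i = 0 := by
          by_contra hne; exact hi (h3 hne)
        omega
  obtain ⟨c, rfl⟩ := (Submodule.mem_span_range_iff_exists_fun k).1 (hle hr)
  refine Finset.sum_eq_zero fun v _ => ?_
  have := h0 v.1 v.2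
  rw [map_sum, Finset.sum_eq_single v] at this
  · rw [map_smul, cf_emn k h β hβ v.1 v.1 v.2 v.2] at this
    simp at this
    rw [this, zero_smul]
  · intro w _ hne
    rw [map_smul, cf_emn k h β hβ v.1 w.1 v.2 w.2, if_neg, smul_zero]
    intro heq; exact hne (Subtype.ext heq)
  · simp

end HelperFace

section HelperMain

variable {P : Type} [Fintype P] [PartialOrder P] [OrderBot P] {n : ℕ}

/-- the set `B` -/
abbrev sB (ℓ : ℕ) (α : Fin n → ℤ) : Finset (Fin n) :=
  Finset.univ.filter fun i : Fin n => -(ℓ:ℤ) < α i ∧ α i < 0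
/-- the set `C` -/
abbrev sC (ℓ : ℕ) (α : Fin n → ℤ) : Finset (Fin n) :=
  Finset.univ.filter fun i : Fin n => α i = -(ℓ:ℤ)
/-- the set `D` -/
abbrev sD (α : Fin n → ℤ) : Finset (Fin n) := Finset.univ.filter fun i : Fin n => 0 < α i

lemma mem_sB {ℓ : ℕ} {α : Fin n → ℤ} {i : Fin n} : i ∈ sB ℓ α ↔ -(ℓ:ℤ) < α i ∧ α i < 0 := by simp
lemma mem_sC {ℓ : ℕ} {α : Fin n → ℤ} {i : Fin n} : i ∈ sC ℓ α ↔ α i = -(ℓ:ℤ) := by simp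
lemma mem_sD {α : Fin n → ℤ} {i : Fin n} : i ∈ sD α ↔ 0 < α i := by simp

/-- index set of the faces `z` -/
abbrev ZT (x : Fin n → P) (ℓ : ℕ) (α : Fin n → ℤ) :=
  {z : P // ∀ i : Fin n, x i ≤ z ↔ i ∈ sB ℓ α ∪ sD α}

/-- the product poset -/
abbrev QT (x : Fin n → P) (ℓ : ℕ) (α : Fin n → ℤ) (z : P) :=
  ↥(Set.Icc (⊥ : P) (subface P n x z (sD α))) ×
    {w : P // z ≤ w ∧ ∀ i ∈ sC ℓ α, ¬ x i ≤ w}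

variable {x : Fin n → P} {ℓ : ℕ} {α : Fin n → ℤ}

lemma subface_spec (h : SP x) (z : ZT x ℓ α) :
    subface P n x z.1 (sD α) ≤ z.1 ∧ ∀ i, x i ≤ subface P n x z.1 (sD α) ↔ i ∈ sD α := by
  have hS : sD α ⊆ sp x z.1 := fun i hi => mem_sp.2 ((z.2 i).2 (Finset.mem_union_right _ hi))
  exact @Classical.epsilon_spec_aux P ⟨⊥⟩
    (fun w => w ≤ z.1 ∧ ∀ i : Fin n, x i ≤ w ↔ i ∈ sD α)
    ⟨fce x z.1 (sD α), h.fce_le hS, fun i => by rw [← mem_sp, h.sp_fce hS]⟩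

/-- the cell dimension set -/
def GQ {z : P} (q : QT x ℓ α z) : Finset (Fin n) :=
  sB ℓ α ∪ sC ℓ α ∪ sp x q.1.1 ∪ (sp x q.2.1 \ (sB ℓ α ∪ sD α))

lemma mem_GQ {z : P} {q : QT x ℓ α z} {i : Fin n} : i ∈ GQ q ↔
    i ∈ sB ℓ α ∨ i ∈ sC ℓ α ∨ x i ≤ q.1.1 ∨ (x i ≤ q.2.1 ∧ i ∉ sB ℓ α ∧ i ∉ sD α) := by
  simp only [GQ, Finset.mem_union, Finset.mem_sdiff, mem_sp, not_or, or_assoc]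

lemma le_one (h : SP x) {z : ZT x ℓ α} (q : QT x ℓ α z.1) (i : Fin n) :
    x i ≤ q.1.1 ↔ i ∈ sD α ∧ i ∈ GQ q := by
  have h1 : x i ≤ q.1.1 → i ∈ sD α := fun hi =>
    ((subface_spec h z).2 i).1 (hi.trans q.1.2.2)
  rw [mem_GQ]
  rw [mem_sB, mem_sC]
  rw [mem_sD] at *
  constructor
  · intro hi
    exact ⟨h1 hi, Or.inr (Or.inr (Or.inl hi))⟩
  · rintro ⟨hd, hh | hh | hh | hh⟩
    · omega
    · omega
    · exact hh
    · exact absurd hd hh.2.2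

lemma le_two {z : ZT x ℓ α} (h : SP x) (q : QT x ℓ α z.1) (i : Fin n) :
    x i ≤ q.2.1 ↔ i ∈ sB ℓ α ∨ i ∈ sD α ∨ (i ∈ GQ q ∧ i ∉ sC ℓ α) := by
  have h1 : i ∈ sB ℓ α ∨ i ∈ sD α → x i ≤ q.2.1 := fun hi =>
    ((z.2 i).2 (Finset.mem_union.2 hi)).trans q.2.2.1
  have h2 : i ∈ sC ℓ α → ¬ x i ≤ q.2.1 := q.2.2.2 i
  have h3 := le_one h q i
  rw [mem_GQ] at *
  tauto

lemma GQ_sup {z : P} (q : QT x ℓ α z) : sB ℓ α ∪ sC ℓ α ⊆ GQ q := by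
  intro i hi
  rw [mem_GQ]
  rw [Finset.mem_union] at hi
  tauto

/-- bottom cell -/
def bQ (h : SP x) (z : ZT x ℓ α) : QT x ℓ α z.1 :=
  (⟨⊥, le_rfl, bot_le⟩, ⟨z.1, le_rfl, fun i hi hx => by
    have := (z.2 i).1 hx
    rw [Finset.mem_union, mem_sB, mem_sD] at this
    rw [mem_sC] at hi
    omega⟩)

lemma GQ_bQ (h : SP x) (z : ZT x ℓ α) : GQ (bQ h z) = sB ℓ α ∪ sC ℓ α := by
  ext i
  rw [mem_GQ]
  have h1 : ¬ x i ≤ (⊥ : P) := by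
    rw [← mem_sp, h.sp_bot]; simp
  have h2 := z.2 i
  rw [Finset.mem_union] at *
  change _ ∨ _ ∨ x i ≤ (⊥ : P) ∨ (x i ≤ z.1 ∧ _) ↔ _
  tauto

lemma GQ_bQ_card (h : SP x) (hℓ : 0 < ℓ) (z : ZT x ℓ α) :
    (GQ (bQ h z)).card = (sB ℓ α).card + (sC ℓ α).card := by
  rw [GQ_bQ, Finset.card_union_of_disjoint]
  rw [Finset.disjoint_left]
  intro i
  rw [mem_sB, mem_sC]
  omega

lemma QT_uniq (h : SP x) {z : ZT x ℓ α} {q₁ q₂ : QT x ℓ α z.1} {w : P} (h1 : q₁.2.1 ≤ w)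
    (h2 : q₂.2.1 ≤ w) (hG : GQ q₁ = GQ q₂) : q₁ = q₂ := by
  refine Prod.ext (Subtype.ext ?_) (Subtype.ext ?_)
  · refine h.uniq q₁.1.2.2 q₂.1.2.2 ?_
    ext i
    rw [mem_sp, mem_sp, le_one h, le_one h, hG]
  · refine h.uniq h1 h2 ?_
    ext i
    rw [mem_sp, mem_sp, le_two h, le_two h, hG]

lemma QT_exists (h : SP x) (hℓ : 0 < ℓ) {z : ZT x ℓ α} {w : P} (hz : z.1 ≤ w) (u : P)
    (hu : u ≤ subface P n x z.1 (sD α)) (S : Finset (Fin n))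
    (hS : sB ℓ α ∪ sC ℓ α ⊆ S) (hw : ∀ i ∈ S, i ∉ sC ℓ α → x i ≤ w)
    (hSu : ∀ i ∈ S, i ∈ sD α → x i ≤ u) :
    ∃ q : QT x ℓ α z.1, GQ q = S ∧ q.1.1 ≤ u ∧ q.2.1 ≤ w := by
  have hz' : ∀ i, i ∈ sB ℓ α ∪ sD α → x i ≤ w := fun i hi => ((z.2 i).2 hi).trans hz
  have hs1 : S ∩ sD α ⊆ sp x u := fun i hi => by
    rw [Finset.mem_inter] at hi
    exact mem_sp.2 (hSu i hi.1 hi.2)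
  have hs2 : (sB ℓ α ∪ sD α) ∪ (S \ sC ℓ α) ⊆ sp x w := fun i hi => by
    rw [Finset.mem_union, Finset.mem_sdiff] at hi
    rcases hi with hi | hi
    · exact mem_sp.2 (hz' i hi)
    · exact mem_sp.2 (hw i hi.1 hi.2)
  have e1 : ∀ i, x i ≤ fce x u (S ∩ sD α) ↔ i ∈ S ∧ i ∈ sD α := fun i => by
    rw [← mem_sp, h.sp_fce hs1, Finset.mem_inter]
  have e2 : ∀ i, x i ≤ fce x w ((sB ℓ α ∪ sD α) ∪ (S \ sC ℓ α)) ↔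
      (i ∈ sB ℓ α ∨ i ∈ sD α) ∨ (i ∈ S ∧ i ∉ sC ℓ α) := fun i => by
    rw [← mem_sp, h.sp_fce hs2, Finset.mem_union, Finset.mem_union, Finset.mem_sdiff]
  refine ⟨(⟨fce x u (S ∩ sD α), bot_le, (h.fce_le hs1).trans hu⟩,
    ⟨fce x w ((sB ℓ α ∪ sD α) ∪ (S \ sC ℓ α)), ?_, ?_⟩), ?_, h.fce_le hs1, h.fce_le hs2⟩
  · refine h.le_of_sp hz (h.fce_le hs2) ?_
    intro i hi
    rw [mem_sp] at *
    rw [e2]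
    exact Or.inl (Finset.mem_union.1 ((z.2 i).1 hi))
  · intro i hi
    rw [e2]
    rw [mem_sC] at *
    rw [mem_sB, mem_sD]
    omega
  · ext i
    rw [mem_GQ]
    change _ ∨ _ ∨ x i ≤ fce x u (S ∩ sD α) ∨
      (x i ≤ fce x w ((sB ℓ α ∪ sD α) ∪ (S \ sC ℓ α)) ∧ _) ↔ _
    rw [e1, e2]
    have := @hS i
    rw [Finset.mem_union] at this
    have hBD : i ∈ sB ℓ α → i ∉ sD α := by rw [mem_sB, mem_sD]; omega
    have hCD : i ∈ sC ℓ α → i ∉ sD α := by rw [mem_sC, mem_sD]; omega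
    tauto

/-- face map -/
def fcQ {z : P} (q : QT x ℓ α z) (S : Finset (Fin n)) : QT x ℓ α z :=
  if hh : ∃ q', q' ≤ q ∧ GQ q' = S then hh.choose else q

lemma fcQ_spec (h : SP x) (hℓ : 0 < ℓ) {z : ZT x ℓ α} (q : QT x ℓ α z.1) (S : Finset (Fin n))
    (hS : sB ℓ α ∪ sC ℓ α ⊆ S) (hq : S ⊆ GQ q) : fcQ q S ≤ q ∧ GQ (fcQ q S) = S := by
  have hh : ∃ q', q' ≤ q ∧ GQ q' = S := by
    obtain ⟨q', h1, h2, h3⟩ := QT_exists h hℓ q.2.2.1 q.1.1 q.1.2.2 S hS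
      (fun i hi hc => (le_two h q i).2 (Or.inr (Or.inr ⟨hq hi, hc⟩)))
      (fun i hi hd => (le_one h q i).2 ⟨hd, hq hi⟩)
    exact ⟨q', ⟨h2, h3⟩, h1⟩
  rw [fcQ, dif_pos hh]
  exact hh.choose_spec

lemma cellQ (h : SP x) (hℓ : 0 < ℓ) (z : ZT x ℓ α) :
    CellData (Q := QT x ℓ α z.1) GQ (bQ h z) fcQ where
  hb q := ⟨bot_le (a := q.1.1), q.2.2.1⟩
  mono q q' hq := by
    intro i
    rw [mem_GQ, mem_GQ]
    have h1 : x i ≤ q.1.1 → x i ≤ q'.1.1 := fun hi => hi.trans hq.1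
    have h2 : x i ≤ q.2.1 → x i ≤ q'.2.1 := fun hi => hi.trans hq.2
    tauto
  fc_le q S hS hq := (fcQ_spec h hℓ q S (GQ_bQ h z ▸ hS) hq).1
  G_fc q S hS hq := (fcQ_spec h hℓ q S (GQ_bQ h z ▸ hS) hq).2
  uniq q q₁ q₂ h1 h2 hG := QT_uniq h h1.2 h2.2 hG

/-- shifted degree -/
abbrev bt (ℓ : ℕ) (α : Fin n → ℤ) (G : Finset (Fin n)) : Fin n → ℤ :=
  fun j => α j + if j ∈ G then (ℓ : ℤ) else 0

lemma bt_nonneg (hα : ∀ i, -(ℓ : ℤ) ≤ α i) {G : Finset (Fin n)} (hG : sB ℓ α ∪ sC ℓ α ⊆ G)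
    (i : Fin n) : 0 ≤ bt ℓ α G i := by
  have h1 := @hG i
  have h2 := hα i
  rw [Finset.mem_union, mem_sB, mem_sC] at h1
  simp only [bt]
  split_ifs with hi
  · omega
  · by_contra hc
    exact hi (h1 (by omega))

lemma bt_pos (hℓ : 0 < ℓ) (hα : ∀ i, -(ℓ : ℤ) ≤ α i) {G : Finset (Fin n)}
    (hG : sB ℓ α ∪ sC ℓ α ⊆ G) (i : Fin n) :
    0 < bt ℓ α G i ↔ i ∈ sB ℓ α ∨ i ∈ sD α ∨ (i ∈ G ∧ i ∉ sC ℓ α) := by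
  have h1 := @hG i
  have h2 := hα i
  rw [Finset.mem_union] at h1
  rw [mem_sB, mem_sC] at *
  rw [mem_sD]
  simp only [bt]
  split_ifs with hi
  · simp only [hi, true_and]; omega
  · simp only [hi, false_and, or_false]
    constructor
    · intro; right; omega
    · rintro (hh | hh)
      · exact absurd (h1 (Or.inl hh)) hi
      · omega

lemma bt_neg (hℓ : 0 < ℓ) {G : Finset (Fin n)}
    (hG : ¬ sB ℓ α ∪ sC ℓ α ⊆ G) : ∃ i, bt ℓ α G i < 0 := by
  rw [Finset.not_subset] at hG
  obtain ⟨i, hi, hi'⟩ := hG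
  refine ⟨i, ?_⟩
  rw [Finset.mem_union, mem_sB, mem_sC] at hi
  simp only [bt, hi', if_false]
  omega

lemma le_two_iff (h : SP x) (hℓ : 0 < ℓ) (hα : ∀ i, -(ℓ : ℤ) ≤ α i) {z : ZT x ℓ α}
    (q : QT x ℓ α z.1) (i : Fin n) : x i ≤ q.2.1 ↔ 0 < bt ℓ α (GQ q) i := by
  rw [le_two h, bt_pos hℓ hα (GQ_sup q)]

lemma exists_cell (h : SP x) (hℓ : 0 < ℓ) (hα : ∀ i, -(ℓ : ℤ) ≤ α i) {G : Finset (Fin n)}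
    (hG : sB ℓ α ∪ sC ℓ α ⊆ G) {w : P} (hw : ∀ i, x i ≤ w ↔ 0 < bt ℓ α G i) :
    ∃ (z : ZT x ℓ α) (q : QT x ℓ α z.1), GQ q = G ∧ q.2.1 = w := by
  have hw' := fun i => (hw i).trans (bt_pos hℓ hα hG i)
  have hs : sB ℓ α ∪ sD α ⊆ sp x w := fun i hi => by
    rw [mem_sp, hw']
    rw [Finset.mem_union] at hi
    tauto
  let z : ZT x ℓ α := ⟨fce x w (sB ℓ α ∪ sD α), fun i => by rw [← mem_sp, h.sp_fce hs]⟩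
  obtain ⟨q, h1, h2, h3⟩ := QT_exists h hℓ (z := z) (w := w) (h.fce_le hs)
    (subface P n x z.1 (sD α)) le_rfl G hG (fun i hi hc => (hw' i).2 (Or.inr (Or.inr ⟨hi, hc⟩)))
    (fun i _ hd => ((subface_spec h z).2 i).2 hd)
  refine ⟨z, q, h1, h.uniq h3 le_rfl ?_⟩
  ext i
  rw [mem_sp, mem_sp, le_two_iff h hℓ hα, h1, hw]

lemma cell_uniq (h : SP x) {z z' : ZT x ℓ α} (q : QT x ℓ α z.1) (q' : QT x ℓ α z'.1)
    (hG : GQ q = GQ q') (hw : q.2.1 = q'.2.1) :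
    (⟨z, q⟩ : Σ z : ZT x ℓ α, QT x ℓ α z.1) = ⟨z', q'⟩ := by
  have hz : z = z' := Subtype.ext (h.uniq q.2.2.1 (hw ▸ q'.2.2.1) (by
    ext i
    rw [mem_sp, mem_sp, z.2, z'.2]))
  subst hz
  rw [QT_uniq h le_rfl hw.ge hG]

variable (k : Type) [Field k]

lemma mem_gradedKC {t : ℕ} {f : KCochain P k n} : f ∈ gradedKC P k n x ℓ t α ↔
    ∀ G, (G.card = t → f G ∈ facePiece P k n x (bt ℓ α G)) ∧ (G.card ≠ t → f G = 0) := by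
  rw [gradedKC, Submodule.mem_pi]
  refine forall_congr' fun G => ?_
  by_cases hG : G.card = t
  · simp [hG]
  · simp [hG]

lemma gradedKC_mem {t : ℕ} {f : KCochain P k n} (hf : f ∈ gradedKC P k n x ℓ t α)
    (G : Finset (Fin n)) : f G ∈ facePiece P k n x (bt ℓ α G) := by
  have := (mem_gradedKC k).1 hf G
  by_cases hG : G.card = t
  · exact this.1 hG
  · rw [this.2 hG]; exact zero_mem _

lemma koszulD_apply (f : KCochain P k n) (G : Finset (Fin n)) :
    koszulD P k n x ℓ f G =
      ∑ j ∈ G, sg k (· < ·) G j • (fv P k (x j) ^ ℓ * f (G.erase j)) := by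
  simp only [koszulD, sg, LinearMap.pi_apply, LinearMap.sum_apply, LinearMap.smul_apply,
    LinearMap.comp_apply, LinearMap.mulLeft_apply, LinearMap.proj_apply]

lemma bt_erase (G : Finset (Fin n)) {j : Fin n} (hj : j ∈ G) :
    (fun i => bt ℓ α (G.erase j) i + if i = j then (ℓ : ℤ) else 0) = bt ℓ α G := by
  funext i
  by_cases hi : i = j
  · subst hi; simp [bt, hj]
  · simp [bt, hi]

lemma koszulD_gr (h : SP x) {t : ℕ} {f : KCochain P k n} (hf : f ∈ gradedKC P k n x ℓ t α) :
    koszulD P k n x ℓ f ∈ gradedKC P k n x ℓ (t + 1) α := by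
  rw [mem_gradedKC]
  intro G
  rw [koszulD_apply]
  refine ⟨fun _ => ?_, fun hG => ?_⟩
  · refine Submodule.sum_mem _ fun j hj => Submodule.smul_mem _ _ ?_
    have := facePiece_mul k h _ j ℓ (gradedKC_mem k hf (G.erase j))
    rwa [bt_erase G hj] at this
  · refine Finset.sum_eq_zero fun j hj => ?_
    rw [((mem_gradedKC k).1 hf (G.erase j)).2, mul_zero, smul_zero]
    have := Finset.card_erase_add_one hj
    omega

/-- comparison map -/
def rho (h : SP x) (z : ZT x ℓ α) : KCochain P k n →ₗ[k] (QT x ℓ α z.1 → k) :=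
  LinearMap.pi fun q => (cf k h q.2.1 (bt ℓ α (GQ q))).comp (LinearMap.proj (GQ q))

lemma rho_apply (h : SP x) (z : ZT x ℓ α) (f : KCochain P k n) (q : QT x ℓ α z.1) :
    rho k h z f q = cf k h q.2.1 (bt ℓ α (GQ q)) (f (GQ q)) := rfl

lemma rho_gr (h : SP x) (z : ZT x ℓ α) {t : ℕ} {f : KCochain P k n}
    (hf : f ∈ gradedKC P k n x ℓ t α) : rho k h z f ∈ grCell (Q := QT x ℓ α z.1) GQ k t := by
  intro q hq
  rw [rho_apply, ((mem_gradedKC k).1 hf (GQ q)).2 (by exact_mod_cast hq), map_zero]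

lemma rho_d (h : SP x) (hℓ : 0 < ℓ) (hα : ∀ i, -(ℓ : ℤ) ≤ α i) (z : ZT x ℓ α) {t : ℕ}
    {f : KCochain P k n} (hf : f ∈ gradedKC P k n x ℓ t α) :
    rho k h z (koszulD P k n x ℓ f) = dCell GQ (bQ h z) fcQ k (rho k h z f) := by
  funext q
  have hc := cellQ h hℓ z
  rw [rho_apply, koszulD_apply, map_sum]
  change _ = ∑ j ∈ GQ q \ GQ (bQ h z), sg k (· < ·) (GQ q) j *
    rho k h z f (fcQ q ((GQ q).erase j))
  rw [← Finset.sum_subset (Finset.sdiff_subset (s := GQ q) (t := GQ (bQ h z)))]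
  · refine Finset.sum_congr rfl fun j hj => ?_
    have hle := CellData.erase_le _ _ _ hc hj
    have hG := CellData.G_erase _ _ _ hc hj
    have hj' := Finset.mem_sdiff.1 hj
    rw [GQ_bQ, Finset.mem_union, mem_sB, mem_sC] at hj'
    have hmem := gradedKC_mem k hf ((GQ q).erase j)
    have hjw : x j ≤ q.2.1 := by
      rw [le_two h, mem_sC]
      exact Or.inr (Or.inr ⟨hj'.1, fun hh => hj'.2 (Or.inr hh)⟩)
    rw [map_smul, smul_eq_mul, rho_apply, hG]
    congr 1
    have e := cf_mul k h (bt ℓ α ((GQ q).erase j)) j ℓ q.2.1 hjw (by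
      have := hα j
      simp only [bt, Finset.notMem_erase, if_false]
      omega) (f ((GQ q).erase j))
    rw [bt_erase _ hj'.1] at e
    rw [e]
    refine cf_sub k h _ hle.2 (fun i hi => ?_) hmem
    rw [le_two_iff h hℓ hα, hG]
    exact hi
  · intro j hj hj'
    have hjB : j ∈ sB ℓ α ∪ sC ℓ α := by
      rw [← GQ_bQ h z]
      by_contra hh
      exact hj' (Finset.mem_sdiff.2 ⟨hj, hh⟩)
    have hmem := gradedKC_mem k hf ((GQ q).erase j)
    rw [facePiece_neg k _ j, Submodule.mem_bot] at hmem
    · rw [hmem, mul_zero, smul_zero, map_zero]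
    · rw [Finset.mem_union, mem_sB, mem_sC] at hjB
      simp only [bt, Finset.notMem_erase, if_false]
      omega

lemma rho_inj (h : SP x) (hℓ : 0 < ℓ) (hα : ∀ i, -(ℓ : ℤ) ≤ α i) {t : ℕ}
    {f : KCochain P k n} (hf : f ∈ gradedKC P k n x ℓ t α)
    (h0 : ∀ z : ZT x ℓ α, rho k h z f = 0) : f = 0 := by
  funext G
  have hm := gradedKC_mem k hf G
  by_cases hG : sB ℓ α ∪ sC ℓ α ⊆ G
  · refine facePiece_inj k h _ (bt_nonneg hα hG) hm fun w hw => ?_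
    obtain ⟨z, q, rfl, rfl⟩ := exists_cell h hℓ hα hG hw
    exact congrFun (h0 z) q
  · obtain ⟨i, hi⟩ := bt_neg hℓ hG
    rw [facePiece_neg k _ i hi] at hm
    exact (Submodule.mem_bot _).1 hm

lemma rho_surj (h : SP x) (hℓ : 0 < ℓ) (hα : ∀ i, -(ℓ : ℤ) ≤ α i) {t : ℕ}
    (g : ∀ z : ZT x ℓ α, QT x ℓ α z.1 → k)
    (hg : ∀ z, g z ∈ grCell (Q := QT x ℓ α z.1) GQ k t) :
    ∃ f ∈ gradedKC P k n x ℓ t α, ∀ z : ZT x ℓ α, rho k h z f = g z := by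
  let c : Finset (Fin n) → P → k := fun G w =>
    if hh : ∃ s : Σ z : ZT x ℓ α, QT x ℓ α z.1, GQ s.2 = G ∧ s.2.2.1 = w then
      g hh.choose.1 hh.choose.2 else 0
  have hc : ∀ (z : ZT x ℓ α) (q : QT x ℓ α z.1), c (GQ q) q.2.1 = g z q := by
    intro z q
    have hh : ∃ s : Σ z : ZT x ℓ α, QT x ℓ α z.1, GQ s.2 = GQ q ∧ s.2.2.1 = q.2.1 :=
      ⟨⟨z, q⟩, rfl, rfl⟩
    have e := cell_uniq h hh.choose.2 q hh.choose_spec.1 hh.choose_spec.2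
    simp only [c]
    rw [dif_pos hh]
    exact congrArg (fun s : Σ z : ZT x ℓ α, QT x ℓ α z.1 => g s.1 s.2) e
  have hr : ∀ G : Finset (Fin n), ∃ r : FaceRing P k,
      (G.card = t → r ∈ facePiece P k n x (bt ℓ α G)) ∧ (G.card ≠ t → r = 0) ∧
      (G.card = t → sB ℓ α ∪ sC ℓ α ⊆ G → ∀ v, (∀ i, x i ≤ v ↔ 0 < bt ℓ α G i) →
        cf k h v (bt ℓ α G) r = c G v) := by
    intro G
    by_cases hG : G.card = t ∧ sB ℓ α ∪ sC ℓ α ⊆ G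
    · obtain ⟨r, h1, h2⟩ := facePiece_lift k h _ (bt_nonneg hα hG.2) (c G)
      exact ⟨r, fun _ => h1, fun hh => absurd hG.1 hh, fun _ _ => h2⟩
    · exact ⟨0, fun _ => zero_mem _, fun _ => rfl, fun h1 h2 => absurd ⟨h1, h2⟩ hG⟩
  choose f h1 h2 h3 using hr
  refine ⟨f, (mem_gradedKC k).2 fun G => ⟨h1 G, h2 G⟩, fun z => ?_⟩
  funext q
  rw [rho_apply]
  by_cases hq : (GQ q).card = t
  · rw [h3 _ hq (GQ_sup q) _ (le_two_iff h hℓ hα q), hc]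
  · rw [h2 _ hq, map_zero]
    exact (hg z q (by exact_mod_cast hq)).symm

theorem ext_cell (h : SP x) (hℓ : 0 < ℓ) (hα : ∀ i, -(ℓ : ℤ) ≤ α i) (t : ℕ) :
    Nonempty (ExtPiece P k n x ℓ t α ≃ₗ[k]
      ((z : ZT x ℓ α) → CellCoh (Q := QT x ℓ α z.1) GQ (bQ h z) fcQ k t)) := by
  refine qi_pi (ZK P k n x ℓ t α) (BK P k n x ℓ t α)
    (fun z => LinearMap.ker (dCell GQ (bQ h z) fcQ k) ⊓ grCell (Q := QT x ℓ α z.1) GQ k t)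
    (fun z => Submodule.map (dCell GQ (bQ h z) fcQ k) (grCell (Q := QT x ℓ α z.1) GQ k (t - 1)))
    (fun z => rho k h z) ?_ ?_ ?_
  · intro v hv z
    refine ⟨?_, rho_gr k h z hv.2⟩
    rw [SetLike.mem_coe, LinearMap.mem_ker, ← rho_d k h hℓ hα z hv.2, LinearMap.mem_ker.1 hv.1, map_zero]
  · intro v hv
    cases t with
    | zero =>
      constructor
      · rintro ⟨u, hu, rfl⟩ z
        have : koszulD P k n x ℓ u = 0 := by
          funext G
          by_cases hG : G.card = 0
          · rw [Finset.card_eq_zero] at hG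
            subst hG
            rw [koszulD_apply, Finset.sum_empty]; rfl
          · exact ((mem_gradedKC k).1 hv.2 G).2 hG
        rw [this, map_zero]
        exact zero_mem _
      · intro hh
        have : v = 0 := rho_inj k h hℓ hα hv.2 fun z => by
          obtain ⟨g, hg, hgv⟩ := hh z
          have : g = 0 := by
            funext q
            refine hg q ?_
            have : (0:ℤ) ≤ (GQ q).card := by positivity
            push_cast
            omega
          rw [← hgv, this, map_zero]
        rw [this]
        exact zero_mem _
    | succ s =>
      have es : ((s + 1 : ℕ) : ℤ) - 1 = (s : ℤ) := by push_cast; ring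
      rw [es]
      constructor
      · rintro ⟨u, hu, rfl⟩ z
        exact ⟨rho k h z u, rho_gr k h z hu, (rho_d k h hℓ hα z hu).symm⟩
      · intro hh
        choose g hg hgv using hh
        obtain ⟨u, hu, hug⟩ := rho_surj k h hℓ hα g hg
        refine ⟨u, hu, ?_⟩
        rw [← sub_eq_zero]
        refine rho_inj k h hℓ hα (t := s + 1) (sub_mem (koszulD_gr k h hu) hv.2) fun z => ?_
        rw [map_sub, rho_d k h hℓ hα z hu, hug, hgv, sub_self]
  · intro w hw
    obtain ⟨v, hv, hvw⟩ := rho_surj k h hℓ hα w fun z => (hw z).2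
    refine ⟨v, ⟨?_, hv⟩, fun z => ?_⟩
    · rw [SetLike.mem_coe, LinearMap.mem_ker]
      refine rho_inj k h hℓ hα (koszulD_gr k h hv) fun z => ?_
      rw [rho_d k h hℓ hα z hv, hvw]
      exact (hw z).1
    · rw [hvw, sub_self]
      exact zero_mem _

end HelperMain

theorem ext_hochster_formula
    (hP : IsSimplicialPoset P)
    (hinj : Function.Injective x) (hatom : ∀ i, IsAtom (x i))
    (hsurj : ∀ a : P, IsAtom a → ∃ i, x i = a)
    (ℓ : ℕ) (hℓ : 0 < ℓ) (α : Fin n → ℤ)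
    (hα : ∀ i, -(ℓ : ℤ) ≤ α i) (t : ℕ) :
    Nonempty (ExtPiece P k n x ℓ t α ≃ₗ[k]
      ((z : {z : P // ∀ i : Fin n, x i ≤ z ↔
            (i ∈ (Finset.univ.filter fun i : Fin n => -(ℓ:ℤ) < α i ∧ α i < 0) ∪
                 (Finset.univ.filter fun i : Fin n => 0 < α i))}) →
        ReducedCoh k
          (↥(Set.Icc (⊥ : P)
              (subface P n x (z : P) (Finset.univ.filter fun i : Fin n => 0 < α i))) ×
           {w : P // (z : P) ≤ w ∧
              ∀ i ∈ (Finset.univ.filter fun i : Fin n => α i = -(ℓ:ℤ)), ¬ x i ≤ w})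
          ((t : ℤ) - (Finset.univ.filter fun i : Fin n => -(ℓ:ℤ) < α i ∧ α i < 0).card
            - (Finset.univ.filter fun i : Fin n => α i = -(ℓ:ℤ)).card - 1))) := by
  have h : SP x := ⟨hP, hinj, hatom, hsurj⟩
  obtain ⟨e⟩ := ext_cell k h hℓ hα t
  have hz : ∀ z : ZT x ℓ α, Nonempty (CellCoh (Q := QT x ℓ α z.1) GQ (bQ h z) fcQ k t ≃ₗ[k]
      ReducedCoh k (QT x ℓ α z.1) ((t : ℤ) - (sB ℓ α).card - (sC ℓ α).card - 1)) := fun z => by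
    have := cellCoh_equiv (Q := QT x ℓ α z.1) GQ (bQ h z) fcQ k (cellQ h hℓ z) t
    rw [GQ_bQ_card h hℓ z] at this
    have e : (t : ℤ) - (sB ℓ α).card - (sC ℓ α).card - 1 =
      (t : ℤ) - ((sB ℓ α).card + (sC ℓ α).card : ℕ) - 1 := by push_cast; ring
    rw [e]
    exact this
  exact ⟨e.trans (LinearEquiv.piCongrRight fun z => (hz z).some)⟩

end
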